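/- arXiv:1906.09659 — 3 statements merged into one kernel-verified Lean document; each statement's English description precedes it below -/
import Mathlib

section
/- Let k be a positive integer, let π be a permutation of {1,...,k}, and let A_π be the k×k permutation matrix of π. There exist constants C = C(π) and C' = C'(π) > 0 such that for every n and every n×n 0-1 matrix M containing a ones, with Cn ≤ a ≤ n², the matrix M contains at least C'·a^(2k-1)/n^(2k-2) copies of A_π. -/
/-- The number of copies of the `k × k` permutation matrix `A_π` in the `n × n`
0-1 matrix `M`: pairs of strictly increasing row/column index tuples such that
`M` has a one at `(x i, y (π i))` for every `i`. -/
noncomputable def matCopies {k n : ℕ} (π : Equiv.Perm (Fin k))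
    (M : Fin n → Fin n → Bool) : ℕ :=
  Nat.card {xy : (Fin k → Fin n) × (Fin k → Fin n) //
    StrictMono xy.1 ∧ StrictMono xy.2 ∧ ∀ i, M (xy.1 i) (xy.2 (π i)) = true}

/-- The number of ones in a 0-1 matrix. -/
noncomputable def matOnes {n : ℕ} (M : Fin n → Fin n → Bool) : ℕ :=
  Nat.card {ij : Fin n × Fin n // M ij.1 ij.2 = true}

open Finset

/-- `E` contains the permutation pattern `π`. -/
def ContainsPattern {k : ℕ} {α β : Type*} [LinearOrder α] [LinearOrder β]
    (π : Equiv.Perm (Fin k)) (E : Finset (α × β)) : Prop :=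
  ∃ (x : Fin k → α) (y : Fin k → β), StrictMono x ∧ StrictMono y ∧ ∀ i, (x i, y (π i)) ∈ E

theorem ContainsPattern.of_image {k : ℕ} {α β γ δ : Type*} [LinearOrder α] [LinearOrder β]
    [LinearOrder γ] [LinearOrder δ] {π : Equiv.Perm (Fin k)} {E : Finset (α × β)}
    {f : α → γ} {g : β → δ} (hf : Monotone f) (hg : Monotone g)
    (h : ContainsPattern π (E.image (Prod.map f g))) : ContainsPattern π E := by
  obtain ⟨x, y, hx, hy, h⟩ := h
  have h' : ∀ i, ∃ p ∈ E, f p.1 = x i ∧ g p.2 = y (π i) := by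
    intro i
    obtain ⟨p, hp, hpe⟩ := mem_image.1 (h i)
    exact ⟨p, hp, congrArg Prod.fst hpe, congrArg Prod.snd hpe⟩
  choose p hpE hp1 hp2 using h'
  refine ⟨fun i => (p i).1, fun j => (p (π.symm j)).2, ?_, ?_, ?_⟩
  · intro i j hij
    apply hf.reflect_lt
    rw [hp1, hp1]
    exact hx hij
  · intro i j hij
    apply hg.reflect_lt
    rw [hp2, hp2]
    simpa using hy hij
  · intro i
    simpa using hpE i

theorem ContainsPattern.of_swap {k : ℕ} {α β : Type*} [LinearOrder α] [LinearOrder β]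
    {π : Equiv.Perm (Fin k)} {E : Finset (α × β)}
    (h : ContainsPattern π.symm (E.image Prod.swap)) : ContainsPattern π E := by
  obtain ⟨x, y, hx, hy, h⟩ := h
  refine ⟨y, x, hy, hx, fun i => ?_⟩
  obtain ⟨p, hp, hpe⟩ := mem_image.1 (h (π i))
  rw [π.symm_apply_apply] at hpe
  rwa [← Prod.swap_swap p, hpe] at hp

/-- The points of `E` in the `s × s` block with index `q`. -/
def blockPoints (s : ℕ) (E : Finset (ℕ × ℕ)) (q : ℕ × ℕ) : Finset (ℕ × ℕ) :=
  E.filter fun p => Prod.map (· / s) (· / s) p = q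

theorem mem_blockPoints {s : ℕ} {E : Finset (ℕ × ℕ)} {q p : ℕ × ℕ} :
    p ∈ blockPoints s E q ↔ p ∈ E ∧ p.1 / s = q.1 ∧ p.2 / s = q.2 := by
  simp [blockPoints, Prod.ext_iff]

theorem image_snd_blockPoints_subset {s : ℕ} (hs : 0 < s) (E : Finset (ℕ × ℕ)) (q : ℕ × ℕ) :
    (blockPoints s E q).image Prod.snd ⊆ Ico (s * q.2) (s * q.2 + s) := by
  intro c hc
  obtain ⟨p, hp, rfl⟩ := mem_image.1 hc
  rw [← (mem_blockPoints.1 hp).2.2, mem_Ico]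
  exact ⟨Nat.mul_div_le _ _, by simpa [mul_add] using Nat.lt_mul_div_succ p.2 hs⟩

theorem image_swap_blockPoints (s : ℕ) (E : Finset (ℕ × ℕ)) (q : ℕ × ℕ) :
    blockPoints s (E.image Prod.swap) q.swap = (blockPoints s E q).image Prod.swap := by
  ext ⟨a, b⟩
  simp only [mem_blockPoints, mem_image, Prod.exists, Prod.swap_prod_mk, Prod.mk.injEq,
    Prod.fst_swap, Prod.snd_swap]
  constructor
  · rintro ⟨⟨u, v, h, rfl, rfl⟩, h1, h2⟩
    exact ⟨u, v, ⟨h, h2, h1⟩, rfl, rfl⟩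
  · rintro ⟨u, v, ⟨h, h1, h2⟩, rfl, rfl⟩
    exact ⟨⟨u, v, h, rfl, rfl⟩, h2, h1⟩

/-- In a set avoiding `π`, few blocks of a given block column meet at least `k` columns. -/
theorem card_wide_blocks_in_column_le {k s : ℕ} (hs : 0 < s) {π : Equiv.Perm (Fin k)}
    {E : Finset (ℕ × ℕ)} (hE : ¬ ContainsPattern π E) (J : ℕ) (T : Finset ℕ)
    (hT : ∀ I ∈ T, k ≤ ((blockPoints s E (I, J)).image Prod.snd).card) :
    T.card ≤ 2 ^ s * k := by
  by_contra! hlt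
  have hcard : (Ico (s * J) (s * J + s)).powerset.card = 2 ^ s := by simp
  rw [← hcard] at hlt
  obtain ⟨W, -, hW⟩ := exists_lt_card_fiber_of_mul_lt_card_of_maps_to
    (f := fun I => (blockPoints s E (I, J)).image Prod.snd)
    (fun I _ => mem_powerset.2 (image_snd_blockPoints_subset hs E (I, J))) hlt
  obtain ⟨I₀, hI₀⟩ := card_pos.1 (Nat.zero_lt_of_lt hW)
  have hkW : k ≤ W.card := by
    rw [mem_filter] at hI₀
    rw [← hI₀.2]
    exact hT _ hI₀.1
  have hp : ∀ i : Fin k, ∃ p ∈ E, p.1 / s = orderEmbOfCardLe _ hW.le i ∧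
      p.2 = orderEmbOfCardLe W hkW (π i) := by
    intro i
    have hb := (mem_filter.1 (orderEmbOfCardLe_mem _ hW.le i)).2
    have hw := orderEmbOfCardLe_mem W hkW (π i)
    obtain ⟨p, hp, hpe⟩ := mem_image.1 (hb.ge hw)
    rw [mem_blockPoints] at hp
    exact ⟨p, hp.1, hp.2.1, hpe⟩
  choose p hpE hp1 hp2 using hp
  refine hE ⟨fun i => (p i).1, orderEmbOfCardLe W hkW, ?_, (orderEmbOfCardLe W hkW).strictMono, ?_⟩
  · intro i j hij
    have hmono : Monotone (· / s) := fun a b h => Nat.div_le_div_right h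
    apply hmono.reflect_lt
    simp only [hp1]
    exact (orderEmbOfCardLe _ hW.le).strictMono hij
  · intro i
    rw [← hp2]
    exact hpE i

theorem card_wide_blocks_le {k s m : ℕ} (hs : 0 < s) {π : Equiv.Perm (Fin k)}
    {E : Finset (ℕ × ℕ)} (hE : ¬ ContainsPattern π E) (Q : Finset (ℕ × ℕ))
    (hQm : ∀ q ∈ Q, q.2 < m)
    (hQ : ∀ q ∈ Q, k ≤ ((blockPoints s E q).image Prod.snd).card) :
    Q.card ≤ 2 ^ s * k * m := by
  have := card_le_mul_card_image_of_maps_to (s := Q) (t := range m) (f := Prod.snd)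
    (fun q hq => mem_range.2 (hQm q hq)) (2 ^ s * k) ?_
  · simpa using this
  intro J _
  rw [← card_image_of_injOn (f := Prod.fst)]
  · apply card_wide_blocks_in_column_le hs hE J
    intro I hI
    obtain ⟨⟨a, b⟩, hq, rfl⟩ := mem_image.1 hI
    obtain ⟨hqQ, rfl⟩ := mem_filter.1 hq
    exact hQ _ hqQ
  · rintro ⟨a, b⟩ h ⟨c, d⟩ h' e
    simp_all

/-- The Marcus–Tardos block recursion. -/
theorem card_le_of_blocks {k s m : ℕ} (hs : 0 < s) {π : Equiv.Perm (Fin k)}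
    {E : Finset (ℕ × ℕ)} (hE : ¬ ContainsPattern π E)
    (hm : ∀ p ∈ E, p.1 < s * m ∧ p.2 < s * m) :
    E.card ≤ k ^ 2 * (E.image (Prod.map (· / s) (· / s))).card + 2 * s ^ 2 * (2 ^ s * k * m) := by
  set E' := E.image (Prod.map (· / s) (· / s))
  have hswap : ∀ q, ((blockPoints s E q).image Prod.fst) =
      (blockPoints s (E.image Prod.swap) q.swap).image Prod.snd := by
    intro q
    rw [image_swap_blockPoints, image_image]
    rfl
  have hE'm : ∀ q ∈ E', q.1 < m ∧ q.2 < m := by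
    intro q hq
    obtain ⟨p, hp, rfl⟩ := mem_image.1 hq
    exact ⟨Nat.div_lt_of_lt_mul (hm p hp).1, Nat.div_lt_of_lt_mul (hm p hp).2⟩
  have hwide : (E'.filter fun q => k ≤ ((blockPoints s E q).image Prod.snd).card).card
      ≤ 2 ^ s * k * m :=
    card_wide_blocks_le hs hE _ (fun q hq => (hE'm q (mem_filter.1 hq).1).2)
      fun q hq => (mem_filter.1 hq).2
  have htall : (E'.filter fun q => k ≤ ((blockPoints s E q).image Prod.fst).card).card
      ≤ 2 ^ s * k * m := by
    rw [← card_image_of_injective _ Prod.swap_injective]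
    apply card_wide_blocks_le hs (π := π.symm) (E := E.image Prod.swap)
      (fun h => hE h.of_swap)
    · intro q hq
      obtain ⟨p, hp, rfl⟩ := mem_image.1 hq
      exact (hE'm p (mem_filter.1 hp).1).1
    · intro q hq
      obtain ⟨p, hp, rfl⟩ := mem_image.1 hq
      rw [← hswap]
      exact (mem_filter.1 hp).2
  have hcols : ∀ q, ((blockPoints s E q).image Prod.snd).card ≤ s := fun q => by
    simpa using card_le_card (image_snd_blockPoints_subset hs E q)
  have hrows : ∀ q, ((blockPoints s E q).image Prod.fst).card ≤ s := fun q => by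
    rw [hswap]
    simpa using card_le_card (image_snd_blockPoints_subset hs (E.image Prod.swap) q.swap)
  have hblock : ∀ q, (blockPoints s E q).card ≤ k ^ 2 +
      s ^ 2 * (if k ≤ ((blockPoints s E q).image Prod.snd).card then 1 else 0) +
      s ^ 2 * (if k ≤ ((blockPoints s E q).image Prod.fst).card then 1 else 0) := by
    intro q
    have h1 : (blockPoints s E q).card ≤ ((blockPoints s E q).image Prod.fst).card *
        ((blockPoints s E q).image Prod.snd).card := by
      rw [← card_product]
      exact card_le_card subset_product
    have h2 := h1.trans (Nat.mul_le_mul (hrows q) (hcols q))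
    rw [← sq] at h2
    split_ifs with hc hr hr
    · omega
    · omega
    · omega
    · have := h1.trans (Nat.mul_le_mul (not_le.1 hr).le (not_le.1 hc).le)
      rw [← sq] at this
      omega
  calc E.card = ∑ q ∈ E', (blockPoints s E q).card := card_eq_sum_card_image _ _
    _ ≤ _ := sum_le_sum fun q _ => hblock q
    _ = k ^ 2 * E'.card +
        s ^ 2 * (E'.filter fun q => k ≤ ((blockPoints s E q).image Prod.snd).card).card +
        s ^ 2 * (E'.filter fun q => k ≤ ((blockPoints s E q).image Prod.fst).card).card := by
      rw [sum_add_distrib, sum_add_distrib, ← mul_sum, ← mul_sum, card_filter, card_filter,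
        sum_const, smul_eq_mul, mul_comm (E'.card)]
    _ ≤ k ^ 2 * E'.card + s ^ 2 * (2 ^ s * k * m) + s ^ 2 * (2 ^ s * k * m) := by gcongr
    _ = _ := by ring

theorem card_le_of_avoids_pow {k s : ℕ} (hk : 0 < k) (hs : s = k ^ 2 + 1)
    {π : Equiv.Perm (Fin k)} (t : ℕ) :
    ∀ E : Finset (ℕ × ℕ), ¬ ContainsPattern π E → (∀ p ∈ E, p.1 < s ^ t ∧ p.2 < s ^ t) →
      E.card ≤ 2 * s ^ 2 * (2 ^ s * k) * s ^ t := by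
  have hs0 : 0 < s := by omega
  induction t with
  | zero =>
    intro E _ hm
    have : E ⊆ {(0, 0)} := by
      rintro ⟨a, b⟩ hp
      have := hm _ hp
      simp at this
      simp [this]
    refine (card_le_card this).trans ?_
    rw [card_singleton]
    exact Nat.succ_le_of_lt (by positivity)
  | succ t ih =>
    intro E hE hm
    rw [pow_succ'] at hm
    have hmono : Monotone (· / s) := fun a b h => Nat.div_le_div_right h
    have h1 := card_le_of_blocks hs0 hE hm
    have h2 := ih (E.image (Prod.map (· / s) (· / s)))
      (fun h => hE (h.of_image hmono hmono)) (by
        intro q hq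
        obtain ⟨p, hp, rfl⟩ := mem_image.1 hq
        exact ⟨Nat.div_lt_of_lt_mul (hm p hp).1, Nat.div_lt_of_lt_mul (hm p hp).2⟩)
    calc E.card ≤ _ := h1
      _ ≤ k ^ 2 * (2 * s ^ 2 * (2 ^ s * k) * s ^ t) + 2 * s ^ 2 * (2 ^ s * k * s ^ t) := by gcongr
      _ = 2 * s ^ 2 * (2 ^ s * k) * ((k ^ 2 + 1) * s ^ t) := by ring
      _ = _ := by rw [← hs, pow_succ' s t]

theorem monotone_card_filter_lt {α : Type*} [LinearOrder α] (R : Finset α) :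
    Monotone fun a => (R.filter (· < a)).card := fun _ _ h =>
  card_le_card (monotone_filter_right R fun _ _ hc => lt_of_lt_of_le hc h)

theorem strictMonoOn_card_filter_lt {α : Type*} [LinearOrder α] (R : Finset α) :
    StrictMonoOn (fun a => (R.filter (· < a)).card) R := fun a ha b _ h =>
  card_lt_card <| (ssubset_iff_of_subset
    (monotone_filter_right R fun _ _ hc => lt_trans hc h)).2 ⟨a, by simpa using ⟨ha, h⟩, by simp⟩

theorem card_filter_lt_lt_card {α : Type*} [LinearOrder α] {R : Finset α} {a : α} (ha : a ∈ R) :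
    (R.filter (· < a)).card < R.card :=
  card_lt_card (filter_ssubset.2 ⟨a, ha, lt_irrefl a⟩)

/-- The Marcus–Tardos theorem, for rectangular index sets. -/
theorem exists_card_le_of_avoids {k : ℕ} (hk : 0 < k) (π : Equiv.Perm (Fin k)) :
    ∃ c : ℕ, 0 < c ∧ ∀ {α β : Type} [LinearOrder α] [LinearOrder β] (R : Finset α) (S : Finset β)
      (E : Finset (α × β)), E ⊆ R ×ˢ S → ¬ ContainsPattern π E →
        E.card ≤ c * (R.card + S.card) := by
  obtain ⟨s, hs⟩ : ∃ s, s = k ^ 2 + 1 := ⟨_, rfl⟩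
  have hs0 : 0 < s := by omega
  have hs1 : 1 < s := by have := pow_pos hk 2; omega
  refine ⟨2 * s ^ 2 * (2 ^ s * k) * s, by positivity, ?_⟩
  intro α β _ _ R S E hRS hE
  rcases E.eq_empty_or_nonempty with rfl | ⟨p₀, hp₀⟩
  · simp
  set m := R.card + S.card with hm
  have hm0 : m ≠ 0 := by
    have : 0 < R.card := card_pos.2 ⟨_, (mem_product.1 (hRS hp₀)).1⟩
    omega
  set f := fun a => (R.filter (· < a)).card
  set g := fun a => (S.filter (· < a)).card
  have hlog : m < s ^ (Nat.log s m + 1) := Nat.lt_pow_succ_log_self hs1 m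
  have key := card_le_of_avoids_pow hk hs (π := π) (Nat.log s m + 1) (E.image (Prod.map f g))
    (fun h => hE (h.of_image (monotone_card_filter_lt R) (monotone_card_filter_lt S))) (by
      intro q hq
      obtain ⟨p, hp, rfl⟩ := mem_image.1 hq
      have hp' := mem_product.1 (hRS hp)
      have h1 : f p.1 < R.card := card_filter_lt_lt_card hp'.1
      have h2 : g p.2 < S.card := card_filter_lt_lt_card hp'.2
      simp only [Prod.map_fst, Prod.map_snd]
      omega)
  rw [card_image_of_injOn] at key
  · refine key.trans ?_
    rw [pow_succ' s (Nat.log s m), ← mul_assoc]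
    exact Nat.mul_le_mul_left _ (Nat.pow_log_le_self s hm0)
  · intro p hp q hq h
    have hp' := mem_product.1 (hRS hp)
    have hq' := mem_product.1 (hRS hq)
    exact Prod.ext
      ((strictMonoOn_card_filter_lt R).injOn hp'.1 hq'.1 (congrArg Prod.fst h))
      ((strictMonoOn_card_filter_lt S).injOn hp'.2 hq'.2 (congrArg Prod.snd h))

open Classical in
/-- The finite set of copies of `π` in `E`. -/
noncomputable def patternCopies {k n : ℕ} (π : Equiv.Perm (Fin k)) (E : Finset (Fin n × Fin n)) :
    Finset ((Fin k → Fin n) × (Fin k → Fin n)) :=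
  univ.filter fun xy => StrictMono xy.1 ∧ StrictMono xy.2 ∧ ∀ i, (xy.1 i, xy.2 (π i)) ∈ E

theorem mem_patternCopies {k n : ℕ} {π : Equiv.Perm (Fin k)} {E : Finset (Fin n × Fin n)}
    {xy : (Fin k → Fin n) × (Fin k → Fin n)} : xy ∈ patternCopies π E ↔
      StrictMono xy.1 ∧ StrictMono xy.2 ∧ ∀ i, (xy.1 i, xy.2 (π i)) ∈ E := by
  simp [patternCopies]

theorem card_le_add_card_patternCopies {k n B : ℕ} (hk : 0 < k) (π : Equiv.Perm (Fin k))
    (E : Finset (Fin n × Fin n)) (hB : ∀ E' ⊆ E, ¬ ContainsPattern π E' → E'.card ≤ B) :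
    E.card ≤ B + (patternCopies π E).card := by
  set D := (patternCopies π E).image fun xy => (xy.1 ⟨0, hk⟩, xy.2 (π ⟨0, hk⟩))
  have h1 : (E \ D).card ≤ B := by
    refine hB _ sdiff_subset ?_
    rintro ⟨x, y, hx, hy, h⟩
    refine (mem_sdiff.1 (h ⟨0, hk⟩)).2 (mem_image.2 ⟨(x, y), ?_, rfl⟩)
    exact mem_patternCopies.2 ⟨hx, hy, fun i => (mem_sdiff.1 (h i)).1⟩
  have h2 : D.card ≤ (patternCopies π E).card := card_image_le
  have h3 := card_le_card_sdiff_add_card (s := E) (t := D)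
  omega

theorem card_functions_eq_zero_on {n q : ℕ} [NeZero q] (T : Finset (Fin n)) :
    ((univ.filter fun f : Fin n → Fin q => ∀ i ∈ T, f i = 0).card : ℝ) =
      (q : ℝ) ^ n / (q : ℝ) ^ T.card := by
  have hq : (q : ℝ) ≠ 0 := NeZero.ne _
  have h : (univ.filter fun f : Fin n → Fin q => ∀ i ∈ T, f i = 0) =
      Fintype.piFinset fun i => if i ∈ T then {0} else univ := by
    ext f
    simp only [mem_filter, mem_univ, true_and, Fintype.mem_piFinset]
    refine forall_congr' fun i => ?_
    by_cases hi : i ∈ T <;> simp [hi]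
  rw [h, Fintype.card_piFinset, eq_div_iff (pow_ne_zero _ hq)]
  have h2 : ∀ i, (if i ∈ T then ({0} : Finset (Fin q)) else univ).card = if i ∈ T then 1 else q := by
    intro i
    split_ifs <;> simp
  simp only [h2]
  norm_cast
  rw [← prod_const, ← Fintype.prod_ite_mem T fun _ => q, ← prod_mul_distrib]
  have h3 : ∀ i, ((if i ∈ T then 1 else q) * if i ∈ T then q else 1) = q := by
    intro i
    split_ifs <;> simp
  simp [h3]

/-- Averaging over random colourings of the rows and columns. -/
theorem sampling_inequality {k n c q : ℕ} [NeZero q] (hk : 0 < k) {π : Equiv.Perm (Fin k)}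
    (hc : ∀ (R S : Finset (Fin n)) (E : Finset (Fin n × Fin n)), E ⊆ R ×ˢ S →
      ¬ ContainsPattern π E → E.card ≤ c * (R.card + S.card))
    (E : Finset (Fin n × Fin n)) :
    (E.card : ℝ) / q ^ 2 ≤ 2 * c * n / q + (patternCopies π E).card / (q : ℝ) ^ (2 * k) := by
  have hq : (q : ℝ) ≠ 0 := NeZero.ne _
  have pointwise : ∀ f g : Fin n → Fin q,
      ∑ p ∈ E, (if f p.1 = 0 then (1 : ℝ) else 0) * (if g p.2 = 0 then 1 else 0) ≤
        c * (∑ i, (if f i = 0 then (1 : ℝ) else 0) + ∑ i, (if g i = 0 then (1 : ℝ) else 0)) +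
        ∑ xy ∈ patternCopies π E,
          (if ∀ i ∈ univ.image xy.1, f i = 0 then (1 : ℝ) else 0) *
          (if ∀ i ∈ univ.image xy.2, g i = 0 then 1 else 0) := by
    intro f g
    have h := card_le_add_card_patternCopies hk π (E.filter fun p => f p.1 = 0 ∧ g p.2 = 0)
      (B := c * ((univ.filter fun i => f i = 0).card + (univ.filter fun i => g i = 0).card))
      (fun E' hE' => hc _ _ E' (fun p hp => by simpa using (mem_filter.1 (hE' hp)).2))
    have h' : patternCopies π (E.filter fun p => f p.1 = 0 ∧ g p.2 = 0) ⊆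
        (patternCopies π E).filter fun xy =>
          (∀ i ∈ univ.image xy.1, f i = 0) ∧ (∀ i ∈ univ.image xy.2, g i = 0) := by
      intro xy hxy
      obtain ⟨hx, hy, hxy⟩ := mem_patternCopies.1 hxy
      simp only [mem_filter] at hxy
      refine mem_filter.2 ⟨mem_patternCopies.2 ⟨hx, hy, fun i => (hxy i).1⟩, ?_, ?_⟩
      · simpa using fun i => (hxy i).2.1
      · simpa using fun i => by simpa using (hxy (π.symm i)).2.2
    have h2 := h.trans (Nat.add_le_add_left (card_le_card h') _)
    simp only [ite_zero_mul_ite_zero, mul_one, sum_boole]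
    exact_mod_cast h2
  have hsum := sum_le_sum fun f (_ : f ∈ (univ : Finset (Fin n → Fin q))) =>
    sum_le_sum fun g (_ : g ∈ (univ : Finset (Fin n → Fin q))) => pointwise f g
  have hcount : ∀ T : Finset (Fin n),
      ∑ f : Fin n → Fin q, (if ∀ i ∈ T, f i = 0 then (1 : ℝ) else 0) =
        (q : ℝ) ^ n / (q : ℝ) ^ T.card := by
    intro T
    rw [sum_boole, card_functions_eq_zero_on]
  have hcount1 : ∀ i : Fin n,
      ∑ f : Fin n → Fin q, (if f i = 0 then (1 : ℝ) else 0) = (q : ℝ) ^ n / q := by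
    intro i
    simpa using hcount {i}
  have hleft : ∑ f : Fin n → Fin q, ∑ g : Fin n → Fin q,
      ∑ p ∈ E, (if f p.1 = 0 then (1 : ℝ) else 0) * (if g p.2 = 0 then 1 else 0) =
      E.card * ((q : ℝ) ^ n / q * ((q : ℝ) ^ n / q)) := by
    simp_rw [sum_comm (t := E), ← mul_sum, ← sum_mul, hcount1]
    simp
  have hcopies : ∑ f : Fin n → Fin q, ∑ g : Fin n → Fin q, ∑ xy ∈ patternCopies π E,
          (if ∀ i ∈ univ.image xy.1, f i = 0 then (1 : ℝ) else 0) *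
          (if ∀ i ∈ univ.image xy.2, g i = 0 then 1 else 0) =
      (patternCopies π E).card * ((q : ℝ) ^ n / q ^ k * ((q : ℝ) ^ n / q ^ k)) := by
    simp_rw [sum_comm (t := patternCopies π E), ← mul_sum, ← sum_mul, hcount]
    rw [← nsmul_eq_mul, ← sum_const]
    refine sum_congr rfl fun xy hxy => ?_
    obtain ⟨hx, hy, -⟩ := mem_patternCopies.1 hxy
    rw [card_image_of_injective _ hx.injective, card_image_of_injective _ hy.injective]
    simp
  have hsizes : ∑ f : Fin n → Fin q, ∑ g : Fin n → Fin q,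
      (c : ℝ) * (∑ i, (if f i = 0 then (1 : ℝ) else 0) + ∑ i, (if g i = 0 then (1 : ℝ) else 0)) =
      c * (2 * (n * ((q : ℝ) ^ n / q) * q ^ n)) := by
    have h1 : ∑ f : Fin n → Fin q, ∑ i, (if f i = 0 then (1 : ℝ) else 0) =
        n * ((q : ℝ) ^ n / q) := by
      rw [sum_comm]
      simp_rw [hcount1]
      simp
    simp_rw [← mul_sum, sum_add_distrib, sum_const, ← smul_sum, h1]
    simp only [card_univ, Fintype.card_pi, Fintype.card_fin, prod_const, nsmul_eq_mul]
    push_cast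
    ring
  simp_rw [sum_add_distrib] at hsum
  rw [hleft, hsizes, hcopies] at hsum
  have hA : (0 : ℝ) < ((q : ℝ) ^ n) ^ 2 := by positivity
  refine le_of_mul_le_mul_left ?_ hA
  calc _ = (E.card : ℝ) * ((q : ℝ) ^ n / q * ((q : ℝ) ^ n / q)) := by field_simp
    _ ≤ _ := hsum
    _ = _ := by rw [two_mul k, pow_add]; field_simp

theorem matOnes_eq_card {n : ℕ} (M : Fin n → Fin n → Bool) :
    matOnes M = (univ.filter fun p : Fin n × Fin n => M p.1 p.2 = true).card := by
  rw [matOnes, Nat.card_eq_fintype_card, Fintype.card_subtype]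

theorem matCopies_eq_card {k n : ℕ} (π : Equiv.Perm (Fin k)) (M : Fin n → Fin n → Bool) :
    matCopies π M =
      (patternCopies π (univ.filter fun p : Fin n × Fin n => M p.1 p.2 = true)).card := by
  classical
  rw [matCopies, Nat.card_eq_fintype_card, Fintype.card_subtype]
  congr 1
  ext xy
  simp [mem_patternCopies]

theorem supersaturation_01_matrices (k : ℕ) (hk : 0 < k) (π : Equiv.Perm (Fin k)) :
    ∃ C C' : ℝ, 0 < C' ∧
      ∀ (n a : ℕ) (M : Fin n → Fin n → Bool), matOnes M = a →
        C * n ≤ (a : ℝ) → (a : ℝ) ≤ (n : ℝ) ^ 2 →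
        C' * (a : ℝ) ^ (2 * k - 1) / (n : ℝ) ^ (2 * k - 2) ≤ (matCopies π M : ℝ) := by
  obtain ⟨c, hc0, hc⟩ := exists_card_le_of_avoids hk π
  have hcR : (0 : ℝ) < c := by exact_mod_cast hc0
  refine ⟨4 * c, 1 / (2 * (8 * c) ^ (2 * k - 2)), by positivity, ?_⟩
  intro n a M ha hCa han
  obtain ⟨l, hl⟩ : ∃ l, l = 2 * k - 2 := ⟨_, rfl⟩
  rw [show 2 * k - 1 = l + 1 by omega, ← hl]
  rcases Nat.eq_zero_or_pos n with rfl | hn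
  · have : (a : ℝ) = 0 := le_antisymm (by simpa using han) (Nat.cast_nonneg a)
    rw [this]
    simp
  have hnR : (0 : ℝ) < n := by exact_mod_cast hn
  set d : ℝ := 4 * c * n with hd
  have hd0 : 0 < d := by positivity
  have hone : 1 ≤ a / d := (one_le_div hd0).2 hCa
  set q := ⌊a / d⌋₊
  have hq1 : 1 ≤ q := Nat.le_floor (by simpa using hone)
  have : NeZero q := ⟨by omega⟩
  have hqle : (q : ℝ) ≤ a / d := Nat.floor_le (by positivity)
  have hqlt : a / d < q + 1 := Nat.lt_floor_add_one _
  have hq1R : (1 : ℝ) ≤ q := by exact_mod_cast hq1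
  have hqlow : a / (8 * c * n) ≤ (q : ℝ) := by
    have : (a : ℝ) / (8 * c * n) = a / d / 2 := by rw [hd]; field_simp; ring
    rw [this]
    linarith
  have hqa : q * d ≤ a := (le_div_iff₀ hd0).1 hqle
  have hsample := sampling_inequality (q := q) hk (fun R S E => hc R S E)
    (univ.filter fun p : Fin n × Fin n => M p.1 p.2 = true)
  rw [← matOnes_eq_card, ← matCopies_eq_card, ha, show 2 * k = l + 2 by omega] at hsample
  have hq0 : (0 : ℝ) < q := by linarith
  have hmain : (q : ℝ) ^ l * (a - 2 * c * n * q) ≤ matCopies π M := by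
    have h := mul_le_mul_of_nonneg_left hsample (by positivity : (0 : ℝ) ≤ q ^ (l + 2))
    have e1 : (q : ℝ) ^ (l + 2) * (a / q ^ 2) = q ^ l * a := by rw [pow_add]; field_simp
    have e2 : (q : ℝ) ^ (l + 2) * (2 * c * n / q + matCopies π M / q ^ (l + 2)) =
        q ^ l * (2 * c * n * q) + matCopies π M := by rw [pow_add]; field_simp
    rw [e1, e2] at h
    linarith
  calc 1 / (2 * (8 * c) ^ l) * (a : ℝ) ^ (l + 1) / (n : ℝ) ^ l
      = (a / (8 * c * n)) ^ l * (a / 2) := by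
        rw [div_pow, mul_pow (8 * (c : ℝ)) (n : ℝ), pow_succ]; field_simp
    _ ≤ (q : ℝ) ^ l * (a - 2 * c * n * q) := by
        gcongr
        rw [hd] at hqa
        linarith
    _ ≤ _ := hmain
end

section
/- Let k be an integer with k > 1 and π a permutation of {1,...,k}. There exists a constant C = C(π) such that for all nonnegative integers m, n with m ≤ C(n,k) (binomial coefficient), the number of permutations σ of {1,...,n} containing at most m copies of π is at most exp(Cn)·max(1, (m/n)^(n/(k-1))). -/
/-- The number of copies of the `k`-permutation `π` in the `n`-permutation `σ`:
strictly increasing index tuples `x : Fin k → Fin n` such that the entries of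
`σ` at these indices are ordered according to `π`. -/
noncomputable def permCopies {k n : ℕ} (π : Equiv.Perm (Fin k))
    (σ : Equiv.Perm (Fin n)) : ℕ :=
  Nat.card {x : Fin k → Fin n //
    StrictMono x ∧ ∀ i j, π i < π j ↔ σ (x i) < σ (x j)}

open Finset

/-- A tuple of points of the grid, listed from left to right, whose heights are ordered
according to `π`. -/
def IsCopy {k : ℕ} (π : Equiv.Perm (Fin k)) (p : Fin k → ℕ × ℕ) : Prop :=
  StrictMono (fun i => (p i).1) ∧ StrictMono (fun i => (p (π.symm i)).2)

/-- A point set contains no copy of `π`. -/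
def Avoids {k : ℕ} (π : Equiv.Perm (Fin k)) (A : Finset (ℕ × ℕ)) : Prop :=
  ∀ p : Fin k → ℕ × ℕ, (∀ i, p i ∈ A) → ¬ IsCopy π p

/-- The index of the `t × t` block containing a point. -/
def block (t : ℕ) (p : ℕ × ℕ) : ℕ × ℕ := (p.1 / t, p.2 / t)

theorem IsCopy.of_block {k t : ℕ} {π : Equiv.Perm (Fin k)} {p : Fin k → ℕ × ℕ}
    (h : IsCopy π (fun i => block t (p i))) : IsCopy π p :=
  ⟨fun _ _ hij => lt_of_not_ge fun hle => (h.1 hij).not_ge (Nat.div_le_div_right hle),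
    fun _ _ hij => lt_of_not_ge fun hle => (h.2 hij).not_ge (Nat.div_le_div_right hle)⟩

theorem Avoids.image_block {k t : ℕ} {π : Equiv.Perm (Fin k)} {A : Finset (ℕ × ℕ)}
    (h : Avoids π A) : Avoids π (A.image (block t)) := by
  intro q hq hc
  have : ∀ i, ∃ p ∈ A, block t p = q i := fun i => mem_image.1 (hq i)
  choose p hp hpq using this
  refine h p hp (IsCopy.of_block (t := t) ?_)
  simpa only [hpq] using hc

theorem Avoids.image_swap {k : ℕ} {π : Equiv.Perm (Fin k)} {A : Finset (ℕ × ℕ)}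
    (h : Avoids π A) : Avoids π.symm (A.image Prod.swap) := by
  intro p hp hc
  refine h (fun i => (p (π i)).swap) (fun i => ?_) ⟨?_, ?_⟩
  · obtain ⟨a, ha, he⟩ := mem_image.1 (hp (π i))
    rw [← he]
    simpa using ha
  · simpa using hc.2
  · simpa using hc.1

theorem card_wide_le {k K : ℕ} {π : Equiv.Perm (Fin k)} {A : Finset (ℕ × ℕ)}
    (hK : 0 < K) (h : Avoids π A) (I : ℕ) (W : Finset ℕ)
    (hW : ∀ J ∈ W, k ≤ #((A.filter (fun p => block K p = (I, J))).image Prod.fst)) :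
    #W ≤ k * K.choose k := by
  have hT : ∀ J, ∃ T : Finset ℕ, J ∈ W →
      T ⊆ (A.filter (fun p => block K p = (I, J))).image Prod.fst ∧ #T = k := by
    intro J
    by_cases hJ : J ∈ W
    · obtain ⟨T, hT⟩ := exists_subset_card_eq (hW J hJ)
      exact ⟨T, fun _ => hT⟩
    · exact ⟨∅, fun hJ' => absurd hJ' hJ⟩
  choose T hT using hT
  have hsub : W.image T ⊆ powersetCard k (Ico (I * K) (I * K + K)) := by
    intro S hS
    obtain ⟨J, hJ, rfl⟩ := mem_image.1 hS
    refine mem_powersetCard.2 ⟨fun a ha => ?_, (hT J hJ).2⟩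
    obtain ⟨p, hp, rfl⟩ := mem_image.1 ((hT J hJ).1 ha)
    have h1 : p.1 / K = I := congrArg Prod.fst (mem_filter.1 hp).2
    have h2 := Nat.div_add_mod p.1 K
    have h3 := Nat.mod_lt p.1 hK
    rw [h1, mul_comm] at h2
    rw [mem_Ico]
    omega
  have hcard : #(W.image T) ≤ K.choose k := by
    refine (card_le_card hsub).trans ?_
    simp
  refine (card_le_mul_card_image W k ?_).trans (Nat.mul_le_mul_left _ hcard)
  intro S hS
  by_contra! hlt
  obtain ⟨V, hVsub, hVcard⟩ := exists_subset_card_eq hlt.le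
  have hSc : #S = k := (mem_powersetCard.1 (hsub hS)).2
  have hp : ∀ i : Fin k, ∃ p ∈ A, p.1 = S.orderEmbOfFin hSc i ∧
      p.2 / K = V.orderEmbOfFin hVcard (π i) := by
    intro i
    have hJ := mem_filter.1 (hVsub (V.orderEmbOfFin_mem hVcard (π i)))
    have hx := S.orderEmbOfFin_mem hSc i
    have := (hT _ hJ.1).1
    rw [hJ.2] at this
    obtain ⟨p, hp, hpx⟩ := mem_image.1 (this hx)
    exact ⟨p, (mem_filter.1 hp).1, hpx, congrArg Prod.snd (mem_filter.1 hp).2⟩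
  choose p hpA hp1 hp2 using hp
  refine h p hpA ⟨fun i j hij => ?_, fun i j hij => ?_⟩
  · simpa [hp1] using hij
  · refine lt_of_not_ge fun hle => ?_
    have := Nat.div_le_div_right (c := K) hle
    rw [hp2, hp2] at this
    simp only [Equiv.apply_symm_apply, OrderEmbedding.le_iff_le] at this
    exact this.not_gt hij

theorem card_wide_blocks_le_s7 {k K M : ℕ} {π : Equiv.Perm (Fin k)} {A B : Finset (ℕ × ℕ)}
    (hK : 0 < K) (h : Avoids π A) (hB : B ⊆ range M ×ˢ range M) :
    #(B.filter fun q => k ≤ #((A.filter (fun p => block K p = q)).image Prod.fst)) ≤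
      M * (k * K.choose k) := by
  classical
  set W := B.filter fun q => k ≤ #((A.filter (fun p => block K p = q)).image Prod.fst) with hWd
  have h1 : #W ≤ (k * K.choose k) * #(W.image Prod.fst) := by
    refine card_le_mul_card_image W _ fun I _ => ?_
    have hinj : Set.InjOn Prod.snd (W.filter fun q => q.1 = I : Set (ℕ × ℕ)) := by
      intro a ha b hb hab
      simp only [coe_filter, Set.mem_ofPred_eq] at ha hb
      exact Prod.ext (ha.2.trans hb.2.symm) hab
    rw [← card_image_of_injOn (by simpa using hinj)]
    refine card_wide_le hK h I _ fun J hJ => ?_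
    obtain ⟨q, hq, rfl⟩ := mem_image.1 hJ
    obtain ⟨hq1, rfl⟩ := mem_filter.1 hq
    exact (mem_filter.1 hq1).2
  have h2 : #(W.image Prod.fst) ≤ M := by
    have : W.image Prod.fst ⊆ range M := by
      intro a ha
      obtain ⟨q, hq, rfl⟩ := mem_image.1 ha
      exact (mem_product.1 (hB (mem_filter.1 hq).1)).1
    simpa using card_le_card this
  calc #W ≤ _ := h1
    _ ≤ (k * K.choose k) * M := Nat.mul_le_mul_left _ h2
    _ = _ := mul_comm _ _

theorem card_tall_blocks_le {k K M : ℕ} {π : Equiv.Perm (Fin k)} {A B : Finset (ℕ × ℕ)}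
    (hK : 0 < K) (h : Avoids π A) (hB : B ⊆ range M ×ˢ range M) :
    #(B.filter fun q => k ≤ #((A.filter (fun p => block K p = q)).image Prod.snd)) ≤
      M * (k * K.choose k) := by
  have hB' : B.image Prod.swap ⊆ range M ×ˢ range M := by
    intro q hq
    obtain ⟨a, ha, rfl⟩ := mem_image.1 hq
    have := mem_product.1 (hB ha)
    exact mem_product.2 ⟨this.2, this.1⟩
  refine le_trans (card_le_card_of_injOn Prod.swap ?_ Prod.swap_injective.injOn)
    (card_wide_blocks_le_s7 hK h.image_swap hB')
  intro q hq
  rw [mem_coe, mem_filter] at hq ⊢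
  refine ⟨mem_image_of_mem _ hq.1, hq.2.trans (card_le_card ?_)⟩
  intro y hy
  obtain ⟨p, hp, rfl⟩ := mem_image.1 hy
  rw [mem_filter] at hp
  refine mem_image.2 ⟨p.swap, mem_filter.2 ⟨mem_image_of_mem _ hp.1, ?_⟩, rfl⟩
  rw [← hp.2]
  rfl

theorem card_fiber_block_le {K : ℕ} (hK : 0 < K) (A : Finset (ℕ × ℕ)) (q : ℕ × ℕ) :
    #(A.filter fun p => block K p = q) ≤ K ^ 2 := by
  have : (A.filter fun p => block K p = q) ⊆
      Ico (q.1 * K) (q.1 * K + K) ×ˢ Ico (q.2 * K) (q.2 * K + K) := by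
    intro p hp
    obtain ⟨-, rfl⟩ := mem_filter.1 hp
    have h1 := Nat.div_add_mod' p.1 K
    have h2 := Nat.mod_lt p.1 hK
    have h3 := Nat.div_add_mod' p.2 K
    have h4 := Nat.mod_lt p.2 hK
    simp only [block, mem_product, mem_Ico]
    omega
  refine (card_le_card this).trans ?_
  simp [sq]

theorem Avoids.card_le_blocks {k K M : ℕ} {π : Equiv.Perm (Fin k)} {A : Finset (ℕ × ℕ)}
    (hK : 0 < K) (h : Avoids π A) (hB : A.image (block K) ⊆ range M ×ˢ range M) :
    #A ≤ (k - 1) ^ 2 * #(A.image (block K)) + 2 * K ^ 2 * (k * K.choose k) * M := by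
  classical
  set B := A.image (block K)
  set F : ℕ × ℕ → Finset (ℕ × ℕ) := fun q => A.filter fun p => block K p = q
  have hF : ∀ q ∈ B, #(F q) ≤ (k - 1) ^ 2 + ((if k ≤ #((F q).image Prod.fst) then K ^ 2 else 0) +
      (if k ≤ #((F q).image Prod.snd) then K ^ 2 else 0)) := by
    intro q _
    have h1 : #(F q) ≤ K ^ 2 := card_fiber_block_le hK A q
    have h2 : #(F q) ≤ #((F q).image Prod.fst) * #((F q).image Prod.snd) := by
      rw [← card_product]
      exact card_le_card subset_product
    split_ifs with hw ht ht
    · omega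
    · omega
    · omega
    · rw [sq, add_zero, add_zero]
      exact h2.trans (Nat.mul_le_mul (by omega) (by omega))
  calc #A = ∑ q ∈ B, #(F q) := card_eq_sum_card_image _ _
    _ ≤ _ := sum_le_sum hF
    _ = (k - 1) ^ 2 * #B + (#(B.filter fun q => k ≤ #((F q).image Prod.fst)) * K ^ 2 +
          #(B.filter fun q => k ≤ #((F q).image Prod.snd)) * K ^ 2) := by
        rw [sum_add_distrib, sum_add_distrib, ← sum_filter, ← sum_filter]
        simp [mul_comm]
    _ ≤ (k - 1) ^ 2 * #B + (M * (k * K.choose k) * K ^ 2 + M * (k * K.choose k) * K ^ 2) := by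
        gcongr
        · exact card_wide_blocks_le_s7 hK h hB
        · exact card_tall_blocks_le hK h hB
    _ = _ := by ring

theorem Avoids.card_le_pow {k : ℕ} (hk : 1 < k) {π : Equiv.Perm (Fin k)} (j : ℕ) :
    ∀ A : Finset (ℕ × ℕ), Avoids π A →
      A ⊆ range ((k ^ 2) ^ j) ×ˢ range ((k ^ 2) ^ j) →
      #A ≤ 2 * (k ^ 2) ^ 2 * (k * (k ^ 2).choose k) * (k ^ 2) ^ j := by
  have hK : 0 < k ^ 2 := by positivity
  have hD : 1 ≤ 2 * (k ^ 2) ^ 2 * (k * (k ^ 2).choose k) := by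
    have : 0 < (k ^ 2).choose k := Nat.choose_pos (by nlinarith)
    exact Nat.succ_le_of_lt (by positivity)
  induction j with
  | zero =>
    intro A _ hA
    have := card_le_card hA
    simp only [pow_zero, card_product, card_range, mul_one] at this ⊢
    omega
  | succ j ih =>
    intro A h hA
    have hB : A.image (block (k ^ 2)) ⊆ range ((k ^ 2) ^ j) ×ˢ range ((k ^ 2) ^ j) := by
      intro q hq
      obtain ⟨p, hp, rfl⟩ := mem_image.1 hq
      have := mem_product.1 (hA hp)
      simp only [mem_range, pow_succ (k ^ 2)] at this
      simp only [block, mem_product, mem_range]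
      exact ⟨(Nat.div_lt_iff_lt_mul hK).2 this.1, (Nat.div_lt_iff_lt_mul hK).2 this.2⟩
    have h1 := h.card_le_blocks hK hB
    have h2 := ih _ h.image_block hB
    set D := 2 * (k ^ 2) ^ 2 * (k * (k ^ 2).choose k)
    obtain ⟨l, rfl⟩ : ∃ l, k = l + 1 := ⟨k - 1, by omega⟩
    simp only [Nat.add_sub_cancel] at h1
    calc #A ≤ _ := h1
      _ ≤ l ^ 2 * (D * ((l + 1) ^ 2) ^ j) + D * ((l + 1) ^ 2) ^ j := by gcongr
      _ = (l ^ 2 + 1) * (D * ((l + 1) ^ 2) ^ j) := by ring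
      _ ≤ (l + 1) ^ 2 * (D * ((l + 1) ^ 2) ^ j) := by gcongr; nlinarith
      _ = _ := by ring

/-- The Marcus–Tardos theorem. -/
theorem exists_card_le_of_avoids_s7 {k : ℕ} (hk : 1 < k) (π : Equiv.Perm (Fin k)) :
    ∃ c : ℕ, ∀ (N : ℕ) (A : Finset (ℕ × ℕ)), Avoids π A → A ⊆ range N ×ˢ range N →
      #A ≤ c * N := by
  refine ⟨2 * (k ^ 2) ^ 2 * (k * (k ^ 2).choose k) * k ^ 2, fun N A h hA => ?_⟩
  rcases Nat.eq_zero_or_pos N with rfl | hN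
  · simpa using hA
  have hK : 1 < k ^ 2 := Nat.one_lt_pow (by norm_num) hk
  have h1 : N ≤ (k ^ 2) ^ (Nat.log (k ^ 2) N + 1) := (Nat.lt_pow_succ_log_self hK N).le
  have h2 : (k ^ 2) ^ Nat.log (k ^ 2) N ≤ N := Nat.pow_log_le_self _ hN.ne'
  have h3 := Avoids.card_le_pow hk (Nat.log (k ^ 2) N + 1) A h
    (hA.trans (product_subset_product (range_mono h1) (range_mono h1)))
  calc #A ≤ _ := h3
    _ = 2 * (k ^ 2) ^ 2 * (k * (k ^ 2).choose k) * k ^ 2 * (k ^ 2) ^ Nat.log (k ^ 2) N := by ring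
    _ ≤ _ := Nat.mul_le_mul_left _ h2

theorem exists_card_le_of_avoids_product {k : ℕ} (hk : 1 < k) (π : Equiv.Perm (Fin k)) :
    ∃ c : ℕ, ∀ (R S : Finset ℕ) (A : Finset (ℕ × ℕ)), Avoids π A → A ⊆ R ×ˢ S →
      #A ≤ c * (#R + #S) := by
  obtain ⟨c, hc⟩ := exists_card_le_of_avoids_s7 hk π
  refine ⟨c, fun R S A h hA => ?_⟩
  have hrank : ∀ T : Finset ℕ, ∃ r : ℕ → ℕ, Monotone r ∧ Set.InjOn r T ∧ ∀ a ∈ T, r a < #T := by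
    intro T
    have hr : Monotone fun a => #(T.filter (· < a)) := fun a b hab =>
      card_le_card fun x hx => by
        rw [mem_filter] at hx ⊢
        exact ⟨hx.1, hx.2.trans_le hab⟩
    have hlt : ∀ a ∈ T, ∀ b, a < b → #(T.filter (· < a)) < #(T.filter (· < b)) := by
      intro a ha b hab
      refine card_lt_card ((ssubset_iff_of_subset fun x hx => ?_).2 ⟨a, by simp [ha, hab], by simp⟩)
      rw [mem_filter] at hx ⊢
      exact ⟨hx.1, hx.2.trans hab⟩
    refine ⟨_, hr, fun a ha b hb hab => ?_, fun a ha => ?_⟩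
    · rcases lt_trichotomy a b with h' | h' | h'
      · exact absurd hab (hlt a ha b h').ne
      · exact h'
      · exact absurd hab (hlt b hb a h').ne'
    · exact card_lt_card ((ssubset_iff_of_subset (filter_subset _ _)).2 ⟨a, ha, by simp⟩)
  obtain ⟨r, hr, hri, hrl⟩ := hrank R
  obtain ⟨s, hs, hsi, hsl⟩ := hrank S
  have hinj : Set.InjOn (Prod.map r s) A := by
    intro a ha b hb hab
    have h1 := mem_product.1 (hA ha)
    have h2 := mem_product.1 (hA hb)
    exact Prod.ext (hri h1.1 h2.1 (congrArg Prod.fst hab)) (hsi h1.2 h2.2 (congrArg Prod.snd hab))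
  rw [← card_image_of_injOn hinj]
  refine hc _ _ ?_ ?_
  · intro q hq hcopy
    have : ∀ i, ∃ p ∈ A, Prod.map r s p = q i := fun i => mem_image.1 (hq i)
    choose p hp hpq using this
    refine h p hp ⟨fun i j hij => lt_of_not_ge fun hle => ?_,
      fun i j hij => lt_of_not_ge fun hle => ?_⟩
    · have := hcopy.1 hij
      simp only [← hpq] at this
      exact this.not_ge (hr hle)
    · have := hcopy.2 hij
      simp only [← hpq] at this
      exact this.not_ge (hs hle)
  · intro q hq
    obtain ⟨p, hp, rfl⟩ := mem_image.1 hq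
    have := mem_product.1 (hA hp)
    have h1 := hrl _ this.1
    have h2 := hsl _ this.2
    simp only [Prod.map, mem_product, mem_range]
    omega

/-- The copies of `π` in a point set. -/
noncomputable def copies {k : ℕ} (π : Equiv.Perm (Fin k)) (A : Finset (ℕ × ℕ)) :
    Finset (Fin k → ℕ × ℕ) :=
  open Classical in (Fintype.piFinset fun _ => A).filter (IsCopy π)

theorem mem_copies {k : ℕ} {π : Equiv.Perm (Fin k)} {A : Finset (ℕ × ℕ)}
    {p : Fin k → ℕ × ℕ} : p ∈ copies π A ↔ (∀ i, p i ∈ A) ∧ IsCopy π p := by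
  classical
  rw [copies, mem_filter, Fintype.mem_piFinset]

theorem exists_card_le_add_card_copies {k : ℕ} (hk : 1 < k) (π : Equiv.Perm (Fin k)) :
    ∃ c : ℕ, ∀ (R S : Finset ℕ) (A : Finset (ℕ × ℕ)), A ⊆ R ×ˢ S →
      #A ≤ c * (#R + #S) + #(copies π A) := by
  obtain ⟨c, hc⟩ := exists_card_le_of_avoids_product hk π
  refine ⟨c, fun R S A hA => ?_⟩
  let i₀ : Fin k := ⟨0, by omega⟩
  have h := hc R S (A \ (copies π A).image (· i₀)) ?_ (sdiff_subset.trans hA)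
  · have h1 : #((copies π A).image (· i₀)) ≤ #(copies π A) := card_image_le
    have h2 := le_card_sdiff ((copies π A).image (· i₀)) A
    omega
  · intro p hp hcopy
    refine (mem_sdiff.1 (hp i₀)).2 (mem_image.2 ⟨p, mem_copies.2 ⟨fun i => ?_, hcopy⟩, rfl⟩)
    exact (mem_sdiff.1 (hp i)).1

/-- The set of indices to which `f` gives the value `0`. -/
def zeroSet {N Q : ℕ} [NeZero Q] (f : Fin N → Fin Q) : Finset ℕ :=
  (univ.filter (f · = 0)).map Fin.valEmbedding

theorem card_subset_zeroSet_mul {N Q : ℕ} [NeZero Q] {T : Finset ℕ} (hT : T ⊆ range N) :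
    #{f : Fin N → Fin Q | T ⊆ zeroSet f} * Q ^ #T = Q ^ N := by
  have h1 : ({f : Fin N → Fin Q | T ⊆ zeroSet f} : Finset _) =
      Fintype.piFinset fun a : Fin N => if (a : ℕ) ∈ T then {0} else univ := by
    ext f
    simp only [mem_filter, mem_univ, true_and, Fintype.mem_piFinset]
    constructor
    · intro h a
      split_ifs with ha
      · have := h ha
        simp only [zeroSet, mem_map, mem_filter, mem_univ, true_and] at this
        obtain ⟨b, hb, hba⟩ := this
        rw [mem_singleton, ← hb]
        exact congrArg f (Fin.ext hba.symm)
      · exact mem_univ _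
    · intro h a ha
      have := h ⟨a, mem_range.1 (hT ha)⟩
      simp only [ha, if_true, mem_singleton] at this
      exact mem_map.2 ⟨_, by simpa using this, rfl⟩
  have h2 : #(univ.filter fun a : Fin N => (a : ℕ) ∈ T) = #T := by
    rw [← card_map Fin.valEmbedding]
    congr 1
    ext a
    simp only [mem_map, mem_filter, mem_univ, true_and]
    exact ⟨fun ⟨b, hb, hba⟩ => hba ▸ hb, fun ha => ⟨⟨a, mem_range.1 (hT ha)⟩, ha, rfl⟩⟩
  have h3 : (∏ a : Fin N, if (a : ℕ) ∈ T then Q else 1) = Q ^ #T := by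
    rw [prod_ite]
    simp [h2]
  rw [h1, Fintype.card_piFinset, ← h3, ← prod_mul_distrib]
  trans ∏ _a : Fin N, Q
  · refine prod_congr rfl fun a _ => ?_
    split_ifs <;> simp
  · simp

theorem sum_subset_zeroSet {N Q : ℕ} [NeZero Q] {T : Finset ℕ} (hT : T ⊆ range N) :
    ∑ f : Fin N → Fin Q, (if T ⊆ zeroSet f then (1 : ℝ) else 0) = (Q : ℝ) ^ N / (Q : ℝ) ^ #T := by
  have hQ : (Q : ℝ) ≠ 0 := Nat.cast_ne_zero.2 (NeZero.ne Q)
  rw [sum_boole, eq_div_iff (pow_ne_zero _ hQ)]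
  exact_mod_cast card_subset_zeroSet_mul hT

theorem sum_sum_subset_zeroSet {ι : Type*} {N Q : ℕ} [NeZero Q] (s : Finset ι)
    (T U : ι → Finset ℕ) (r : ℕ) (hT : ∀ i ∈ s, T i ⊆ range N ∧ #(T i) = r)
    (hU : ∀ i ∈ s, U i ⊆ range N ∧ #(U i) = r) :
    ∑ f : Fin N → Fin Q, ∑ g : Fin N → Fin Q,
      (#(s.filter fun i => T i ⊆ zeroSet f ∧ U i ⊆ zeroSet g) : ℝ) =
      #s * ((Q : ℝ) ^ N / (Q : ℝ) ^ r) ^ 2 := by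
  have h1 : ∀ f g : Fin N → Fin Q,
      (#(s.filter fun i => T i ⊆ zeroSet f ∧ U i ⊆ zeroSet g) : ℝ) =
      ∑ i ∈ s, (if T i ⊆ zeroSet f then (1 : ℝ) else 0) *
        (if U i ⊆ zeroSet g then (1 : ℝ) else 0) := by
    intro f g
    rw [← sum_boole]
    refine sum_congr rfl fun i _ => ?_
    by_cases h1 : T i ⊆ zeroSet f <;> by_cases h2 : U i ⊆ zeroSet g <;> simp [h1, h2]
  simp only [h1]
  calc _ = ∑ f : Fin N → Fin Q, ∑ i ∈ s, ∑ g : Fin N → Fin Q,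
        (if T i ⊆ zeroSet f then (1 : ℝ) else 0) * (if U i ⊆ zeroSet g then (1 : ℝ) else 0) :=
        sum_congr rfl fun f _ => sum_comm
    _ = ∑ i ∈ s, ∑ f : Fin N → Fin Q, ∑ g : Fin N → Fin Q,
        (if T i ⊆ zeroSet f then (1 : ℝ) else 0) * (if U i ⊆ zeroSet g then (1 : ℝ) else 0) :=
        sum_comm
    _ = ∑ i ∈ s, ((Q : ℝ) ^ N / (Q : ℝ) ^ r) ^ 2 := by
        refine sum_congr rfl fun i hi => ?_
        rw [← sum_mul_sum, sum_subset_zeroSet (hT i hi).1, sum_subset_zeroSet (hU i hi).1,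
          (hT i hi).2, (hU i hi).2, sq]
    _ = _ := by rw [sum_const, nsmul_eq_mul]

theorem sum_card_zeroSet (N Q : ℕ) [NeZero Q] :
    ∑ f : Fin N → Fin Q, (#(zeroSet f) : ℝ) = N * ((Q : ℝ) ^ N / Q) := by
  have h1 : ∀ f : Fin N → Fin Q, (#(zeroSet f) : ℝ) =
      ∑ a ∈ range N, if {a} ⊆ zeroSet f then (1 : ℝ) else 0 := by
    intro f
    rw [sum_boole]
    congr 2
    ext a
    simp only [zeroSet, mem_map, mem_filter, mem_range, singleton_subset_iff]
    exact ⟨fun h => ⟨by obtain ⟨b, -, rfl⟩ := h; exact b.2, h⟩, fun h => h.2⟩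
  simp only [h1]
  rw [sum_comm]
  trans ∑ a ∈ range N, ((Q : ℝ) ^ N / Q)
  · refine sum_congr rfl fun a ha => ?_
    rw [sum_subset_zeroSet (singleton_subset_iff.2 ha), card_singleton, pow_one]
  · rw [sum_const, nsmul_eq_mul, card_range]

theorem exists_card_div_le {k : ℕ} (hk : 1 < k) (π : Equiv.Perm (Fin k)) :
    ∃ c : ℝ, 0 ≤ c ∧ ∀ (N Q : ℕ) (A : Finset (ℕ × ℕ)), 0 < Q → A ⊆ range N ×ˢ range N →
      (#A : ℝ) / (Q : ℝ) ^ 2 ≤ c * (N / Q) + #(copies π A) / (Q : ℝ) ^ (2 * k) := by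
  obtain ⟨c, hc⟩ := exists_card_le_add_card_copies hk π
  refine ⟨2 * c, by positivity, fun N Q A hQ hA => ?_⟩
  have : NeZero Q := ⟨hQ.ne'⟩
  have hQr : (0 : ℝ) < Q := Nat.cast_pos.2 hQ
  have hmem : ∀ p ∈ A, p.1 ∈ range N ∧ p.2 ∈ range N := fun p hp => mem_product.1 (hA hp)
  have key : ∀ f g : Fin N → Fin Q,
      (#(A.filter fun p => {p.1} ⊆ zeroSet f ∧ {p.2} ⊆ zeroSet g) : ℝ) ≤
      c * (#(zeroSet f) + #(zeroSet g)) + #((copies π A).filter fun q =>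
        univ.image (fun i => (q i).1) ⊆ zeroSet f ∧ univ.image (fun i => (q i).2) ⊆ zeroSet g) := by
    intro f g
    have h1 := hc (zeroSet f) (zeroSet g)
      (A.filter fun p => {p.1} ⊆ zeroSet f ∧ {p.2} ⊆ zeroSet g) (fun p hp => by
        simpa using (mem_filter.1 hp).2)
    have h2 : copies π (A.filter fun p => {p.1} ⊆ zeroSet f ∧ {p.2} ⊆ zeroSet g) ⊆
        (copies π A).filter fun q => univ.image (fun i => (q i).1) ⊆ zeroSet f ∧
          univ.image (fun i => (q i).2) ⊆ zeroSet g := by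
      intro q hq
      obtain ⟨hq1, hq2⟩ := mem_copies.1 hq
      simp only [mem_filter, singleton_subset_iff] at hq1
      rw [mem_filter, mem_copies, image_subset_iff, image_subset_iff]
      exact ⟨⟨fun i => (hq1 i).1, hq2⟩, fun i _ => (hq1 i).2.1, fun i _ => (hq1 i).2.2⟩
    exact_mod_cast h1.trans (Nat.add_le_add_left (card_le_card h2) _)
  have hsum := sum_le_sum fun f (_ : f ∈ (univ : Finset (Fin N → Fin Q))) =>
    sum_le_sum fun g (_ : g ∈ (univ : Finset (Fin N → Fin Q))) => key f g
  rw [sum_sum_subset_zeroSet A (fun p => {p.1}) (fun p => {p.2}) 1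
    (fun p hp => ⟨singleton_subset_iff.2 (hmem p hp).1, card_singleton _⟩)
    (fun p hp => ⟨singleton_subset_iff.2 (hmem p hp).2, card_singleton _⟩)] at hsum
  simp only [sum_add_distrib, mul_add] at hsum
  rw [sum_sum_subset_zeroSet (copies π A) (fun q => univ.image fun i => (q i).1)
    (fun q => univ.image fun i => (q i).2) k (fun q hq => ?_) (fun q hq => ?_)] at hsum
  · simp only [← mul_sum, sum_card_zeroSet, sum_const, card_univ, Fintype.card_fun, Fintype.card_fin,
      nsmul_eq_mul, Nat.cast_pow] at hsum
    have hE : (0 : ℝ) < ((Q : ℝ) ^ N) ^ 2 := by positivity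
    rw [← mul_le_mul_iff_left₀ hE]
    calc _ = (#A : ℝ) * ((Q : ℝ) ^ N / (Q : ℝ) ^ 1) ^ 2 := by field_simp
      _ ≤ _ := hsum
      _ = _ := by field_simp; ring
  · obtain ⟨hq1, hq2⟩ := mem_copies.1 hq
    refine ⟨fun a ha => ?_, ?_⟩
    · obtain ⟨i, -, rfl⟩ := mem_image.1 ha
      exact (hmem _ (hq1 i)).1
    · rw [card_image_of_injective _ hq2.1.injective, card_univ, Fintype.card_fin]
  · obtain ⟨hq1, hq2⟩ := mem_copies.1 hq
    refine ⟨fun a ha => ?_, ?_⟩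
    · obtain ⟨i, -, rfl⟩ := mem_image.1 ha
      exact (hmem _ (hq1 i)).2
    · have : Function.Injective fun i => (q i).2 := by
        have h := hq2.2.injective.comp π.injective
        simpa [Function.comp_def] using h
      rw [card_image_of_injective _ this, card_univ, Fintype.card_fin]

theorem exists_card_le_rpow {k : ℕ} (hk : 1 < k) (π : Equiv.Perm (Fin k)) :
    ∃ c : ℝ, 0 ≤ c ∧ ∀ (N : ℕ) (x : ℝ) (A : Finset (ℕ × ℕ)), 1 ≤ x →
      A ⊆ range N ×ˢ range N → (#(copies π A) : ℝ) ≤ N * x ^ k →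
      (#A : ℝ) ≤ c * (N * x ^ (2 / 3 : ℝ)) := by
  obtain ⟨c, hc0, hc⟩ := exists_card_div_le hk π
  refine ⟨2 * c + 1, by positivity, fun N x A hx hA hcop => ?_⟩
  set y : ℝ := x ^ (2 / 3 : ℝ) with hy
  have hx0 : 0 < x := by linarith
  have hy1 : 1 ≤ y := Real.one_le_rpow hx (by norm_num)
  have hy3 : y ^ 3 = x ^ 2 := by
    rw [hy, ← Real.rpow_natCast, ← Real.rpow_mul hx0.le, ← Real.rpow_natCast]
    norm_num
  have hxy : x ^ k ≤ y ^ (2 * k - 1) := by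
    rw [← pow_le_pow_iff_left₀ (by positivity) (by positivity) two_ne_zero, ← pow_mul, ← pow_mul,
      mul_comm k 2, pow_mul, ← hy3, ← pow_mul]
    exact pow_le_pow_right₀ hy1 (by omega)
  set Q := ⌈y⌉₊ with hQ
  have hyQ : y ≤ Q := Nat.le_ceil y
  have hQy : (Q : ℝ) ≤ 2 * y := by
    have := Nat.ceil_lt_add_one (a := y) (by linarith)
    linarith
  have hQ0 : (0 : ℝ) < Q := by linarith
  have h := hc N Q A (Nat.cast_pos.1 hQ0) hA
  rw [div_le_iff₀ (by positivity)] at h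
  have h2 : (#(copies π A) : ℝ) / (Q : ℝ) ^ (2 * k) * (Q : ℝ) ^ 2 ≤ N * y := by
    rw [div_mul_eq_mul_div, div_le_iff₀ (by positivity)]
    calc (#(copies π A) : ℝ) * (Q : ℝ) ^ 2 ≤ N * y ^ (2 * k - 1) * (Q : ℝ) ^ 2 := by
          gcongr
          exact hcop.trans (by gcongr)
      _ = N * y * (y ^ (2 * k - 2) * (Q : ℝ) ^ 2) := by
          rw [show 2 * k - 1 = (2 * k - 2) + 1 by omega, pow_succ]
          ring
      _ ≤ N * y * ((Q : ℝ) ^ (2 * k - 2) * (Q : ℝ) ^ 2) := by gcongr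
      _ = N * y * (Q : ℝ) ^ (2 * k) := by
          rw [← pow_add, show 2 * k - 2 + 2 = 2 * k by omega]
  calc (#A : ℝ) ≤ _ := h
    _ = c * N * Q + (#(copies π A) : ℝ) / (Q : ℝ) ^ (2 * k) * (Q : ℝ) ^ 2 := by
        field_simp
    _ ≤ c * N * (2 * y) + N * y := by gcongr
    _ = _ := by ring

/-- The number of points of `G` in each `t × t` block. -/
def blockCount (t : ℕ) (G : Finset (ℕ × ℕ)) (q : ℕ × ℕ) : ℕ :=
  #(G.filter fun p => block t p = q)

theorem pow_mul_card_copies_le {k t u : ℕ} (π : Equiv.Perm (Fin k)) {G M : Finset (ℕ × ℕ)}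
    (hM : ∀ q ∈ M, u ≤ blockCount t G q) : u ^ k * #(copies π M) ≤ #(copies π G) := by
  classical
  let S := (copies π G).filter fun p => (fun i => block t (p i)) ∈ copies π M
  refine le_trans ?_ (card_le_card (filter_subset _ _ : S ⊆ copies π G))
  refine mul_card_image_le_card_of_maps_to (f := fun (p : Fin k → ℕ × ℕ) i => block t (p i))
    (fun p hp => (mem_filter.1 hp).2) _ fun q hq => ?_
  obtain ⟨hq1, hq2⟩ := mem_copies.1 hq
  calc u ^ k = ∏ _i : Fin k, u := by simp
    _ ≤ ∏ i, blockCount t G (q i) := prod_le_prod' fun i _ => hM _ (hq1 i)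
    _ = #(Fintype.piFinset fun i => G.filter fun p => block t p = q i) := by
        rw [Fintype.card_piFinset]; rfl
    _ ≤ _ := by
        refine card_le_card fun p hp => ?_
        simp only [Fintype.mem_piFinset, mem_filter] at hp
        have hpq : (fun i => block t (p i)) = q := funext fun i => (hp i).2
        refine mem_filter.2 ⟨mem_filter.2 ⟨mem_copies.2 ⟨fun i => (hp i).1, ?_⟩, ?_⟩, hpq⟩
        · exact IsCopy.of_block (t := t) (hpq ▸ hq2)
        · exact hpq ▸ hq

/-- The graph of a permutation, as a set of points of the grid. -/
def permGraph {n : ℕ} (σ : Equiv.Perm (Fin n)) : Finset (ℕ × ℕ) :=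
  univ.image fun x : Fin n => ((x : ℕ), (σ x : ℕ))

theorem permGraph_injective {n : ℕ} (σ : Equiv.Perm (Fin n)) :
    Function.Injective fun x : Fin n => ((x : ℕ), (σ x : ℕ)) :=
  fun _ _ h => Fin.ext (congrArg Prod.fst h)

theorem card_permGraph {n : ℕ} (σ : Equiv.Perm (Fin n)) : #(permGraph σ) = n := by
  rw [permGraph, card_image_of_injective _ (permGraph_injective σ), card_univ, Fintype.card_fin]

theorem card_copies_permGraph_le {k n : ℕ} (π : Equiv.Perm (Fin k)) (σ : Equiv.Perm (Fin n)) :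
    #(copies π (permGraph σ)) ≤ permCopies π σ := by
  classical
  rw [permCopies, Nat.card_eq_fintype_card, Fintype.card_subtype,
    ← card_image_of_injective (s := filter _ _)
      (f := fun (x : Fin k → Fin n) i => ((x i : ℕ), (σ (x i) : ℕ)))
      fun x y h => funext fun i => permGraph_injective σ (congrFun h i)]
  refine card_le_card fun p hp => ?_
  obtain ⟨hp1, hp2, hp3⟩ := mem_copies.1 hp
  have : ∀ i, ∃ x : Fin n, ((x : ℕ), (σ x : ℕ)) = p i := fun i => by
    simpa [permGraph] using hp1 i
  choose x hx using this
  simp only [← hx] at hp2 hp3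
  refine mem_image.2 ⟨x, ?_, funext hx⟩
  refine mem_filter.2 ⟨mem_univ _, fun i j hij => hp2 hij, fun i j => ?_⟩
  have := hp3.lt_iff_lt (a := π i) (b := π j)
  simp only [Equiv.symm_apply_apply] at this
  exact this.symm

/-- The nonempty `t × t` blocks of the graph of a permutation. -/
def blockSupport {n : ℕ} (t : ℕ) (σ : Equiv.Perm (Fin n)) : Finset (ℕ × ℕ) :=
  (permGraph σ).image (block t)

theorem blockCount_ne_zero_iff {n t : ℕ} (σ : Equiv.Perm (Fin n)) (q : ℕ × ℕ) :
    blockCount t (permGraph σ) q ≠ 0 ↔ q ∈ blockSupport t σ := by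
  rw [blockCount, Ne, card_eq_zero, ← Ne, ← nonempty_iff_ne_empty]
  simp [Finset.Nonempty, blockSupport]

theorem blockSupport_subset {n : ℕ} (σ : Equiv.Perm (Fin n)) (t : ℕ) :
    blockSupport t σ ⊆ range (n / t + 1) ×ˢ range (n / t + 1) := by
  intro q hq
  obtain ⟨p, hp, rfl⟩ := mem_image.1 hq
  obtain ⟨x, -, rfl⟩ := mem_image.1 hp
  simp only [block, mem_product, mem_range, Nat.lt_succ_iff]
  exact ⟨Nat.div_le_div_right x.2.le, Nat.div_le_div_right (σ x).2.le⟩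

/-- Blocks of the graph of a permutation with few copies of `π` are rarely heavy. -/
theorem exists_card_heavy_blocks_le {k : ℕ} (hk : 1 < k) (π : Equiv.Perm (Fin k)) :
    ∃ c : ℝ, 0 ≤ c ∧ ∀ (n m t u : ℕ) (x : ℝ) (σ : Equiv.Perm (Fin n)), permCopies π σ ≤ m →
      0 < u → 1 ≤ x → (m : ℝ) ≤ ((n / t + 1 : ℕ) : ℝ) * x ^ k * (u : ℝ) ^ k →
      (#((blockSupport t σ).filter fun q => u ≤ blockCount t (permGraph σ) q) : ℝ) ≤
        c * (((n / t + 1 : ℕ) : ℝ) * x ^ (2 / 3 : ℝ)) := by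
  obtain ⟨c, hc0, hc⟩ := exists_card_le_rpow hk π
  refine ⟨c, hc0, fun n m t u x σ hσ hu hx hm => hc _ _ _ hx
    ((filter_subset _ _).trans (blockSupport_subset σ t)) ?_⟩
  have h1 := pow_mul_card_copies_le (u := u) (t := t) π (G := permGraph σ)
    (M := (blockSupport t σ).filter fun q => u ≤ blockCount t (permGraph σ) q)
    fun q hq => (mem_filter.1 hq).2
  have h2 := (h1.trans (card_copies_permGraph_le π σ)).trans hσ
  have h3 : ((u : ℝ) ^ k) * (#(copies π ((blockSupport t σ).filter fun q =>
      u ≤ blockCount t (permGraph σ) q)) : ℝ) ≤ m := by exact_mod_cast h2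
  have hu' : (0 : ℝ) < (u : ℝ) ^ k := by positivity
  refine le_of_mul_le_mul_left (h3.trans (hm.trans_eq ?_)) hu'
  ring

theorem card_filter_div_eq_le (n t a : ℕ) (ht : 0 < t) :
    #(univ.filter fun y : Fin n => (y : ℕ) / t = a) ≤ t := by
  rw [← card_map Fin.valEmbedding]
  have : (univ.filter fun y : Fin n => (y : ℕ) / t = a).map Fin.valEmbedding ⊆
      Ico (a * t) (a * t + t) := by
    intro y hy
    obtain ⟨z, hz, rfl⟩ := mem_map.1 hy
    have hz' : (z : ℕ) / t = a := (mem_filter.1 hz).2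
    have h1 := Nat.div_add_mod' (z : ℕ) t
    have h2 := Nat.mod_lt (z : ℕ) ht
    rw [hz'] at h1
    simp only [Fin.valEmbedding_apply, mem_Ico]
    omega
  simpa using card_le_card this

theorem blockCount_permGraph {n : ℕ} (σ : Equiv.Perm (Fin n)) (t : ℕ) (q : ℕ × ℕ) :
    blockCount t (permGraph σ) q =
      #(univ.filter fun x : Fin n => block t ((x : ℕ), (σ x : ℕ)) = q) := by
  rw [blockCount, permGraph, filter_image, card_image_of_injective _ (permGraph_injective σ)]

theorem blockCount_permGraph_le {n t : ℕ} (ht : 0 < t) (σ : Equiv.Perm (Fin n)) (q : ℕ × ℕ) :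
    blockCount t (permGraph σ) q ≤ t := by
  rw [blockCount_permGraph]
  refine (card_le_card fun x hx => ?_).trans (card_filter_div_eq_le n t q.1 ht)
  rw [mem_filter] at hx ⊢
  exact ⟨hx.1, congrArg Prod.fst hx.2⟩

theorem sum_blockCount_permGraph_le {n t : ℕ} (ht : 0 < t) (σ : Equiv.Perm (Fin n)) (I : ℕ) :
    ∑ y : Fin n, blockCount t (permGraph σ) (I, (y : ℕ) / t) ≤ t ^ 2 := by
  simp only [blockCount_permGraph, card_filter]
  rw [sum_comm]
  calc _ = ∑ x : Fin n, if (x : ℕ) / t = I then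
        #(univ.filter fun y : Fin n => (y : ℕ) / t = (σ x : ℕ) / t) else 0 := by
        refine sum_congr rfl fun x _ => ?_
        rw [← card_filter]
        split_ifs with h
        · congr 1
          ext y
          simp [block, h, eq_comm]
        · simp [block, h]
    _ ≤ ∑ x : Fin n, if (x : ℕ) / t = I then t else 0 := by
        refine sum_le_sum fun x _ => ?_
        split_ifs
        · exact card_filter_div_eq_le n t _ ht
        · exact le_rfl
    _ = #(univ.filter fun x : Fin n => (x : ℕ) / t = I) * t := by
        rw [← sum_filter, sum_const, smul_eq_mul]
    _ ≤ t ^ 2 := by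
        rw [sq]
        exact Nat.mul_le_mul_right _ (card_filter_div_eq_le n t I ht)

theorem prod_blockCount {n : ℕ} (σ : Equiv.Perm (Fin n)) (t : ℕ) (f : ℕ × ℕ → ℕ) :
    ∏ x : Fin n, f (block t ((x : ℕ), (σ x : ℕ))) =
      ∏ q ∈ blockSupport t σ, f q ^ blockCount t (permGraph σ) q := by
  have := prod_comp (s := permGraph σ) f (block t)
  rw [permGraph, prod_image fun x _ y _ h => permGraph_injective σ h] at this
  exact this

/-- Few permutations have the same block counts. -/
theorem card_same_blockCount_mul_le {n t : ℕ} (ht : 0 < t) (τ : Equiv.Perm (Fin n))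
    (X : Finset (Equiv.Perm (Fin n)))
    (hX : ∀ σ ∈ X, blockCount t (permGraph σ) = blockCount t (permGraph τ)) :
    #X * ∏ q ∈ blockSupport t τ,
        blockCount t (permGraph τ) q ^ blockCount t (permGraph τ) q ≤ (t ^ 2) ^ n := by
  classical
  set b := blockCount t (permGraph τ) with hb
  have h1 : ∀ σ ∈ X, ∏ x : Fin n, b (block t ((x : ℕ), (σ x : ℕ))) =
      ∏ q ∈ blockSupport t τ, b q ^ b q := by
    intro σ hσ
    have hσ' := hX σ hσ
    rw [prod_blockCount, hσ']
    congr 1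
    ext q
    rw [← blockCount_ne_zero_iff, ← blockCount_ne_zero_iff, hσ']
  calc _ = ∑ σ ∈ X, ∏ x : Fin n, b (block t ((x : ℕ), (σ x : ℕ))) := by
        rw [sum_congr rfl h1, sum_const, smul_eq_mul]
    _ = ∑ f ∈ X.image (fun σ : Equiv.Perm (Fin n) => (σ : Fin n → Fin n)),
          ∏ x : Fin n, b (block t ((x : ℕ), (f x : ℕ))) := by
        rw [sum_image fun σ _ σ' _ h => DFunLike.coe_injective h]
    _ ≤ ∑ f : Fin n → Fin n, ∏ x : Fin n, b (block t ((x : ℕ), (f x : ℕ))) :=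
        sum_le_sum_of_subset (subset_univ _)
    _ = ∏ x : Fin n, ∑ y : Fin n, b (block t ((x : ℕ), (y : ℕ))) := by
        rw [prod_univ_sum, Fintype.piFinset_univ]
    _ ≤ ∏ _x : Fin n, t ^ 2 := by
        refine prod_le_prod' fun x _ => ?_
        simpa only [block] using sum_blockCount_permGraph_le ht τ _
    _ = (t ^ 2) ^ n := by simp

theorem sum_rpow_neg_le (t : ℕ) :
    ∑ u ∈ Icc 1 t, (u : ℝ) ^ (-(5 / 6) : ℝ) ≤ 6 * (t : ℝ) ^ (1 / 6 : ℝ) := by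
  induction t with
  | zero => simp
  | succ t ih =>
    rw [sum_Icc_succ_top (by omega)]
    set a : ℝ := ((t + 1 : ℕ) : ℝ) ^ (1 / 6 : ℝ) with ha
    set b : ℝ := (t : ℝ) ^ (1 / 6 : ℝ) with hb
    have h0 : (0 : ℝ) < ((t + 1 : ℕ) : ℝ) := by positivity
    have ha0 : 0 < a := Real.rpow_pos_of_pos h0 _
    have hb0 : 0 ≤ b := Real.rpow_nonneg (Nat.cast_nonneg _) _
    have hba : b ≤ a := Real.rpow_le_rpow (Nat.cast_nonneg _) (by simp) (by norm_num)
    have ha6 : a ^ 6 = t + 1 := by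
      rw [ha, ← Real.rpow_natCast, ← Real.rpow_mul h0.le]
      norm_num
    have hb6 : b ^ 6 = t := by
      rw [hb, ← Real.rpow_natCast, ← Real.rpow_mul (Nat.cast_nonneg _)]
      norm_num
    have ha5 : ((t + 1 : ℕ) : ℝ) ^ (-(5 / 6) : ℝ) = (a ^ 5)⁻¹ := by
      rw [Real.rpow_neg h0.le, ha, ← Real.rpow_natCast, ← Real.rpow_mul h0.le]
      norm_num
    have hdiff : (a - b) * (a ^ 5 + a ^ 4 * b + a ^ 3 * b ^ 2 + a ^ 2 * b ^ 3 + a * b ^ 4 + b ^ 5) =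
        1 := by
      have : (a - b) * (a ^ 5 + a ^ 4 * b + a ^ 3 * b ^ 2 + a ^ 2 * b ^ 3 + a * b ^ 4 + b ^ 5) =
        a ^ 6 - b ^ 6 := by ring
      rw [this, ha6, hb6]; ring
    have hle : a ^ 5 + a ^ 4 * b + a ^ 3 * b ^ 2 + a ^ 2 * b ^ 3 + a * b ^ 4 + b ^ 5 ≤
        6 * a ^ 5 := by
      calc _ ≤ a ^ 5 + a ^ 4 * a + a ^ 3 * a ^ 2 + a ^ 2 * a ^ 3 + a * a ^ 4 + a ^ 5 := by gcongr
        _ = _ := by ring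
    have hkey : (a ^ 5)⁻¹ ≤ 6 * (a - b) := by
      rw [inv_le_iff_one_le_mul₀ (by positivity), ← hdiff]
      calc _ ≤ (a - b) * (6 * a ^ 5) := mul_le_mul_of_nonneg_left hle (by linarith)
        _ = _ := by ring
    rw [ha5]
    linarith

theorem sum_mul_log_div_le {c : ℝ} (hc : 0 ≤ c) {ι : Type*} {t : ℕ} {N : ℝ} (A : Finset ι)
    (b : ι → ℕ) (hb1 : ∀ q ∈ A, 1 ≤ b q) (hbt : ∀ q ∈ A, b q ≤ t)
    (hN : 0 ≤ N) (hA : ∀ u ∈ Icc 1 t, (#(A.filter fun q => u ≤ b q) : ℝ) ≤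
      c * (N * ((t : ℝ) / u) ^ (2 / 3 : ℝ))) :
    ∑ q ∈ A, (b q : ℝ) * Real.log ((t : ℝ) / b q) ≤ 36 * c * (N * t) := by
  have h1 : ∀ q ∈ A, (b q : ℝ) * Real.log ((t : ℝ) / b q) ≤
      ∑ u ∈ Icc 1 t, if u ≤ b q then Real.log ((t : ℝ) / u) else 0 := by
    intro q hq
    have hb := hb1 q hq
    have ht := hbt q hq
    rw [← sum_filter]
    have : (Icc 1 t).filter (· ≤ b q) = Icc 1 (b q) := by
      ext u
      simp only [mem_filter, mem_Icc]
      omega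
    rw [this]
    calc _ = ∑ u ∈ Icc 1 (b q), Real.log ((t : ℝ) / b q) := by simp
      _ ≤ _ := by
        refine sum_le_sum fun u hu => ?_
        rw [mem_Icc] at hu
        have hu0 : (0 : ℝ) < u := by exact_mod_cast hu.1
        have hb0 : (0 : ℝ) < b q := by exact_mod_cast hb
        have ht0 : (0 : ℝ) < t := by exact_mod_cast hb.trans ht
        have hub : (u : ℝ) ≤ b q := by exact_mod_cast hu.2
        gcongr
  calc _ ≤ ∑ q ∈ A, ∑ u ∈ Icc 1 t, (if u ≤ b q then Real.log ((t : ℝ) / u) else 0) :=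
        sum_le_sum h1
    _ = ∑ u ∈ Icc 1 t, (#(A.filter fun q => u ≤ b q) : ℝ) * Real.log ((t : ℝ) / u) := by
        rw [sum_comm]
        refine sum_congr rfl fun u _ => ?_
        rw [← sum_filter, sum_const, nsmul_eq_mul]
    _ ≤ ∑ u ∈ Icc 1 t, (6 * c * N * (t : ℝ) ^ (5 / 6 : ℝ)) * (u : ℝ) ^ (-(5 / 6) : ℝ) := by
        refine sum_le_sum fun u hu => ?_
        have hAu := hA u hu
        rw [mem_Icc] at hu
        have hu0 : (0 : ℝ) < u := by exact_mod_cast hu.1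
        have hut : (u : ℝ) ≤ t := by exact_mod_cast hu.2
        have hx : 1 ≤ (t : ℝ) / u := (one_le_div hu0).2 hut
        have hlog : Real.log ((t : ℝ) / u) ≤ 6 * ((t : ℝ) / u) ^ (1 / 6 : ℝ) := by
          have := Real.log_le_rpow_div (x := (t : ℝ) / u) (by positivity)
            (show (0 : ℝ) < 1 / 6 by norm_num)
          linarith
        calc _ ≤ c * (N * ((t : ℝ) / u) ^ (2 / 3 : ℝ)) * (6 * ((t : ℝ) / u) ^ (1 / 6 : ℝ)) :=
              mul_le_mul hAu hlog (Real.log_nonneg hx) (by positivity)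
          _ = 6 * c * N * (((t : ℝ) / u) ^ (2 / 3 : ℝ) * ((t : ℝ) / u) ^ (1 / 6 : ℝ)) := by ring
          _ = 6 * c * N * ((t : ℝ) / u) ^ (5 / 6 : ℝ) := by
              rw [← Real.rpow_add (by positivity)]
              norm_num
          _ = _ := by
              rw [Real.div_rpow (by positivity) hu0.le, Real.rpow_neg hu0.le]
              ring
    _ ≤ (6 * c * N * (t : ℝ) ^ (5 / 6 : ℝ)) * (6 * (t : ℝ) ^ (1 / 6 : ℝ)) := by
        rw [← mul_sum]
        gcongr
        exact sum_rpow_neg_le t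
    _ = 36 * c * N * ((t : ℝ) ^ (5 / 6 : ℝ) * (t : ℝ) ^ (1 / 6 : ℝ)) := by ring
    _ = _ := by
        rw [← Real.rpow_add_of_nonneg (by positivity) (by norm_num) (by norm_num)]
        norm_num
        ring

theorem card_piAntidiag_le {ι : Type*} [DecidableEq ι] (A : Finset ι) (n : ℕ) :
    #(A.piAntidiag n) ≤ 2 ^ (#A + n) := by
  classical
  have hsub : A.piAntidiag n ⊆ (A.finsuppAntidiag n).image fun f : ι →₀ ℕ => (f : ι → ℕ) := by
    intro f hf
    obtain ⟨h1, h2⟩ := mem_piAntidiag.1 hf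
    refine mem_image.2 ⟨Finsupp.onFinset A f h2, mem_finsuppAntidiag.2 ⟨h1, ?_⟩, rfl⟩
    exact Finsupp.support_onFinset_subset
  calc #(A.piAntidiag n) ≤ #(A.finsuppAntidiag n) := (card_le_card hsub).trans card_image_le
    _ = (#A + n - 1).choose n := card_finsuppAntidiag_nat_eq_choose n
    _ ≤ 2 ^ (#A + n - 1) := Nat.choose_le_two_pow _ _
    _ ≤ 2 ^ (#A + n) := Nat.pow_le_pow_right (by norm_num) (Nat.sub_le _ _)

theorem sum_blockCount {n t : ℕ} (σ : Equiv.Perm (Fin n)) :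
    ∑ q ∈ blockSupport t σ, blockCount t (permGraph σ) q = n := by
  exact (card_eq_sum_card_image (block t) (permGraph σ)).symm.trans (card_permGraph σ)

theorem image_blockSupport {n t : ℕ} (σ : Equiv.Perm (Fin n)) :
    (blockSupport t σ).image (block 2) = blockSupport (t * 2) σ := by
  rw [blockSupport, image_image, blockSupport]
  congr 1
  ext p <;> simp [block, Nat.div_div_eq_div_mul]

theorem card_filter_image_block_two_le (S : Finset (Finset (ℕ × ℕ))) (B : Finset (ℕ × ℕ)) :
    #(S.filter fun A => A.image (block 2) = B) ≤ 16 ^ #B := by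
  have hsub : (S.filter fun A => A.image (block 2) = B) ⊆
      (B.biUnion fun q => Ico (q.1 * 2) (q.1 * 2 + 2) ×ˢ Ico (q.2 * 2) (q.2 * 2 + 2)).powerset := by
    intro A hA
    rw [mem_powerset]
    intro p hp
    rw [mem_biUnion]
    refine ⟨block 2 p, (mem_filter.1 hA).2 ▸ mem_image_of_mem _ hp, ?_⟩
    simp only [block, mem_product, mem_Ico]
    omega
  calc _ ≤ _ := card_le_card hsub
    _ = 2 ^ _ := card_powerset _
    _ ≤ 2 ^ (#B * 4) := by
        refine Nat.pow_le_pow_right (by norm_num) (card_biUnion_le_card_mul _ _ _ fun q _ => ?_)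
        simp
    _ = 16 ^ #B := by rw [mul_comm, pow_mul]; norm_num

theorem card_image_blockSupport_le {n : ℕ} (hn : 0 < n) (X : Finset (Equiv.Perm (Fin n)))
    (s : ℕ → ℕ) (l : ℕ) : ∀ j, n ≤ 2 ^ (j + l) →
      (∀ i, j < i → i ≤ j + l → ∀ σ ∈ X, #(blockSupport (2 ^ i) σ) ≤ s i) →
      #(X.image (blockSupport (2 ^ j))) ≤ 16 ^ ∑ i ∈ range l, s (j + (i + 1)) := by
  induction l with
  | zero =>
    intro j hj _
    have : X.image (blockSupport (2 ^ j)) ⊆ {{(0, 0)}} := by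
      intro A hA
      obtain ⟨σ, -, rfl⟩ := mem_image.1 hA
      rw [mem_singleton, blockSupport, permGraph, image_image]
      have hne : (univ : Finset (Fin n)).Nonempty := ⟨⟨0, hn⟩, mem_univ _⟩
      rw [← image_const hne]
      refine image_congr fun x _ => ?_
      have h1 : (x : ℕ) < 2 ^ j := x.2.trans_le hj
      have h2 : (σ x : ℕ) < 2 ^ j := (σ x).2.trans_le hj
      simp [block, h1, h2]
    simpa using card_le_card this
  | succ l ih =>
    intro j hj hs
    have h1 : (X.image (blockSupport (2 ^ j))).image (image (block 2)) =
        X.image (blockSupport (2 ^ (j + 1))) := by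
      rw [image_image]
      refine image_congr fun σ _ => ?_
      rw [Function.comp_apply, image_blockSupport, pow_succ]
    have h2 := ih (j + 1) (by rwa [show j + 1 + l = j + (l + 1) by omega]) fun i hi hil =>
      hs i (by omega) (by omega)
    have h3 : #(X.image (blockSupport (2 ^ j))) ≤
        16 ^ s (j + 1) * #((X.image (blockSupport (2 ^ j))).image (image (block 2))) := by
      refine card_le_mul_card_image _ _ fun B hB => ?_
      refine (card_filter_image_block_two_le _ B).trans (Nat.pow_le_pow_right (by norm_num) ?_)
      rw [h1] at hB
      obtain ⟨σ, hσ, rfl⟩ := mem_image.1 hB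
      exact hs _ (by omega) (by omega) σ hσ
    rw [h1] at h3
    rw [sum_range_succ', pow_add, mul_comm]
    refine h3.trans (Nat.mul_le_mul_left _ (h2.trans_eq ?_))
    congr 1
    exact sum_congr rfl fun i _ => by congr 1; omega

/-- A bound for the number of permutations in terms of the number of block supports. -/
theorem card_image_blockCount_le [DecidableEq (ℕ × ℕ → ℕ)] {n t s : ℕ}
    (X : Finset (Equiv.Perm (Fin n)))
    (hs : ∀ σ ∈ X, #(blockSupport t σ) ≤ s) :
    #(X.image fun σ => blockCount t (permGraph σ)) ≤
      2 ^ (s + n) * #(X.image (blockSupport t)) := by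
  have hsub : (X.image fun σ => blockCount t (permGraph σ)) ⊆
      (X.image (blockSupport t)).biUnion fun A => A.piAntidiag n := by
    intro b hb
    obtain ⟨σ, hσ, rfl⟩ := mem_image.1 hb
    refine mem_biUnion.2 ⟨_, mem_image_of_mem _ hσ, mem_piAntidiag.2 ⟨sum_blockCount σ, ?_⟩⟩
    exact fun q hq => (blockCount_ne_zero_iff σ q).1 hq
  refine (card_le_card hsub).trans ?_
  rw [mul_comm]
  refine card_biUnion_le_card_mul _ _ _ fun A hA => ?_
  obtain ⟨σ, hσ, rfl⟩ := mem_image.1 hA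
  refine (card_piAntidiag_le _ n).trans (Nat.pow_le_pow_right (by norm_num) ?_)
  exact Nat.add_le_add_right (hs σ hσ) n

theorem exists_scale {k m n : ℕ} (hk : 1 < k) (hn : 0 < n) (hm : m ≤ n ^ k) :
    ∃ j, j ≤ Nat.clog 2 n ∧ m ≤ n * (2 ^ j) ^ (k - 1) ∧
      ((2 : ℝ) ^ j) ^ n ≤ 2 ^ n * max 1 (((m : ℝ) / n) ^ ((n : ℝ) / ((k : ℝ) - 1))) := by
  have hJ : m ≤ n * (2 ^ Nat.clog 2 n) ^ (k - 1) := by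
    calc m ≤ n ^ k := hm
      _ = n * n ^ (k - 1) := by rw [← pow_succ', Nat.sub_add_cancel hk.le]
      _ ≤ _ := by
        gcongr
        exact Nat.le_pow_clog (by norm_num) n
  classical
  have hex : ∃ j, m ≤ n * (2 ^ j) ^ (k - 1) := ⟨_, hJ⟩
  refine ⟨Nat.find hex, Nat.find_min' hex hJ, Nat.find_spec hex, ?_⟩
  have hk1 : ((k - 1 : ℕ) : ℝ) = (k : ℝ) - 1 := by push_cast [hk.le]; ring
  have hk0 : (0 : ℝ) < (k : ℝ) - 1 := by
    rw [← hk1]; exact Nat.cast_pos.2 (by omega)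
  rcases Nat.eq_zero_or_pos (Nat.find hex) with h0 | h0
  · rw [h0, pow_zero, one_pow]
    exact one_le_mul_of_one_le_of_one_le (one_le_pow₀ (by norm_num)) (le_max_left _ _)
  · obtain ⟨i, hi⟩ : ∃ i, Nat.find hex = i + 1 := ⟨_, (Nat.sub_add_cancel h0).symm⟩
    have hlt : n * (2 ^ i) ^ (k - 1) < m := by
      have := Nat.find_min hex (m := i) (by omega)
      omega
    have hlt' : ((2 : ℝ) ^ i) ^ (k - 1) ≤ (m : ℝ) / n := by
      rw [le_div_iff₀ (Nat.cast_pos.2 hn), mul_comm]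
      exact_mod_cast hlt.le
    rw [hi, pow_succ, mul_comm, mul_pow]
    refine mul_le_mul_of_nonneg_left (le_trans ?_ (le_max_right _ _)) (by positivity)
    calc ((2 : ℝ) ^ i) ^ n = (((2 : ℝ) ^ i) ^ (k - 1)) ^ ((n : ℝ) / ((k : ℝ) - 1)) := by
          rw [← Real.rpow_natCast _ (k - 1), ← Real.rpow_mul (by positivity), hk1,
            mul_div_cancel₀ _ hk0.ne', Real.rpow_natCast]
      _ ≤ _ := Real.rpow_le_rpow (by positivity) hlt' (by positivity)

theorem div_two_pow_bounds {n i : ℕ} (hn : 0 < n) (hi : i ≤ Nat.clog 2 n) :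
    n ≤ (n / 2 ^ i + 1) * 2 ^ i ∧ (n / 2 ^ i + 1) * 2 ^ i ≤ 3 * n := by
  have h1 : 2 ^ i ≤ 2 * n := by
    refine (Nat.pow_le_pow_right (by norm_num) hi).trans ?_
    rcases Nat.lt_or_ge 1 n with h | h
    · have h2 := Nat.pow_pred_clog_lt_self (b := 2) (by norm_num) h
      have h3 := Nat.clog_pos (b := 2) (by norm_num) h
      obtain ⟨a, ha⟩ : ∃ a, Nat.clog 2 n = a + 1 := ⟨_, (Nat.sub_add_cancel h3).symm⟩
      rw [ha] at h2 ⊢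
      rw [Nat.pred_succ] at h2
      rw [pow_succ]
      omega
    · simp [Nat.clog_of_right_le_one h]
      omega
  have h2 := Nat.div_add_mod' n (2 ^ i)
  have h3 := Nat.mod_lt n (show 0 < 2 ^ i by positivity)
  rw [add_mul, one_mul]
  omega

/-- The number of permutations with few copies of `π` and the same block counts. -/
theorem card_le_exp_mul_pow_of_blockCount_eq {n t : ℕ} {c : ℝ} (hc : 0 ≤ c) (ht : 0 < t)
    (htn : (n / t + 1) * t ≤ 3 * n) (τ : Equiv.Perm (Fin n))
    (hτ : ∀ u ∈ Icc 1 t, (#((blockSupport t τ).filter fun q =>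
      u ≤ blockCount t (permGraph τ) q) : ℝ) ≤
        c * (((n / t + 1 : ℕ) : ℝ) * ((t : ℝ) / u) ^ (2 / 3 : ℝ)))
    (X : Finset (Equiv.Perm (Fin n)))
    (hX : ∀ σ ∈ X, blockCount t (permGraph σ) = blockCount t (permGraph τ)) :
    (#X : ℝ) ≤ Real.exp (108 * c * n) * (t : ℝ) ^ n := by
  set b := blockCount t (permGraph τ) with hb
  have hb1 : ∀ q ∈ blockSupport t τ, 1 ≤ b q := fun q hq =>
    Nat.one_le_iff_ne_zero.2 ((blockCount_ne_zero_iff τ q).2 hq)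
  have h1 := sum_mul_log_div_le hc (blockSupport t τ) b hb1
    (fun q _ => blockCount_permGraph_le ht τ q) (Nat.cast_nonneg _) hτ
  have h2 : (#X : ℝ) * ∏ q ∈ blockSupport t τ, (b q : ℝ) ^ b q ≤ ((t : ℝ) ^ 2) ^ n := by
    exact_mod_cast card_same_blockCount_mul_le ht τ X hX
  have ht0 : (0 : ℝ) < t := Nat.cast_pos.2 ht
  set P := ∏ q ∈ blockSupport t τ, (b q : ℝ) ^ b q with hP
  have hP0 : 0 < P := prod_pos fun q hq => pow_pos (Nat.cast_pos.2 (hb1 q hq)) _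
  have h3 : (t : ℝ) ^ n = P * ∏ q ∈ blockSupport t τ, ((t : ℝ) / b q) ^ b q := by
    rw [hP, ← prod_mul_distrib]
    have hsum : ∑ q ∈ blockSupport t τ, b q = n := sum_blockCount τ
    rw [← congrArg ((t : ℝ) ^ ·) hsum]
    rw [← prod_pow_eq_pow_sum]
    refine prod_congr rfl fun q hq => ?_
    rw [← mul_pow, mul_div_cancel₀]
    exact Nat.cast_ne_zero.2 (Nat.one_le_iff_ne_zero.1 (hb1 q hq))
  have h4 : ∏ q ∈ blockSupport t τ, ((t : ℝ) / b q) ^ b q ≤ Real.exp (108 * c * n) := by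
    calc _ = Real.exp (∑ q ∈ blockSupport t τ, (b q : ℝ) * Real.log ((t : ℝ) / b q)) := by
          rw [Real.exp_sum]
          refine prod_congr rfl fun q hq => ?_
          have : (0 : ℝ) < b q := Nat.cast_pos.2 (hb1 q hq)
          rw [Real.exp_nat_mul, Real.exp_log (by positivity)]
      _ ≤ _ := by
          refine Real.exp_le_exp.2 (h1.trans ?_)
          have : ((n / t + 1 : ℕ) : ℝ) * t ≤ 3 * n := by exact_mod_cast htn
          calc _ ≤ 36 * c * (3 * n) := by gcongr
            _ = _ := by ring
  refine le_of_mul_le_mul_right ?_ hP0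
  calc (#X : ℝ) * P ≤ ((t : ℝ) ^ 2) ^ n := h2
    _ = (t : ℝ) ^ n * (t : ℝ) ^ n := by rw [← pow_mul, two_mul, pow_add]
    _ = (P * ∏ q ∈ blockSupport t τ, ((t : ℝ) / b q) ^ b q) * (t : ℝ) ^ n := by
        conv_lhs => rw [h3]
        rw [← h3]
    _ ≤ (P * Real.exp (108 * c * n)) * (t : ℝ) ^ n := by gcongr
    _ = _ := by ring

theorem exists_card_few_copies_le {k : ℕ} (hk : 1 < k) (π : Equiv.Perm (Fin k)) :
    ∃ C : ℝ, ∀ (m n : ℕ) (X : Finset (Equiv.Perm (Fin n))), 0 < n → m ≤ n ^ k →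
      (∀ σ ∈ X, permCopies π σ ≤ m) →
      (#X : ℝ) ≤ Real.exp (C * n) *
        max 1 (((m : ℝ) / (n : ℝ)) ^ ((n : ℝ) / ((k : ℝ) - 1))) := by
  classical
  obtain ⟨c, hc0, hc⟩ := exists_card_heavy_blocks_le hk π
  set r : ℝ := 2 ^ (2 / 3 : ℝ) / 2 with hr
  have hr0 : 0 ≤ r := by positivity
  have hr1 : r < 1 := by
    rw [hr, div_lt_one (by norm_num)]
    exact Real.rpow_lt_self_of_one_lt (by norm_num) (by norm_num)
  refine ⟨108 * c + 2 + 9 * c * (1 - r)⁻¹, fun m n X hn hm hX => ?_⟩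
  obtain ⟨j, hjJ, hmj, hjn⟩ := exists_scale hk hn hm
  obtain ⟨l, hl⟩ := Nat.exists_eq_add_of_le hjJ
  set s : ℕ → ℕ := fun i => ⌊3 * c * n * r ^ i⌋₊ with hs
  have hsupp : ∀ i, j ≤ i → i ≤ j + l → ∀ σ ∈ X, #(blockSupport (2 ^ i) σ) ≤ s i := by
    intro i hji hil σ hσ
    obtain ⟨hN1, hN2⟩ := div_two_pow_bounds hn (i := i) (by omega)
    have hmi : m ≤ (n / 2 ^ i + 1) * (2 ^ i) ^ k := by
      calc m ≤ n * (2 ^ j) ^ (k - 1) := hmj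
        _ ≤ (n / 2 ^ i + 1) * 2 ^ i * (2 ^ i) ^ (k - 1) := by
          gcongr
          norm_num
        _ = _ := by rw [mul_assoc, ← pow_succ', Nat.sub_add_cancel hk.le]
    have h1 := hc n m (2 ^ i) 1 (2 ^ i) σ (hX σ hσ) one_pos (one_le_pow₀ (by norm_num)) (by
      rw [Nat.cast_one, one_pow, mul_one]
      exact_mod_cast hmi)
    rw [filter_true_of_mem fun q hq =>
      Nat.one_le_iff_ne_zero.2 ((blockCount_ne_zero_iff σ q).2 hq)] at h1
    refine Nat.le_floor (h1.trans ?_)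
    have h2 : ((2 : ℝ) ^ i) ^ (2 / 3 : ℝ) = 2 ^ i * r ^ i := by
      rw [← mul_pow, hr, mul_div_cancel₀ _ (two_ne_zero), ← Real.rpow_natCast,
        ← Real.rpow_natCast, ← Real.rpow_mul (by norm_num), ← Real.rpow_mul (by norm_num),
        mul_comm]
    have h3 : ((n / 2 ^ i + 1 : ℕ) : ℝ) * 2 ^ i ≤ 3 * n := by exact_mod_cast hN2
    calc _ = c * (((n / 2 ^ i + 1 : ℕ) : ℝ) * 2 ^ i) * r ^ i := by rw [h2]; ring
      _ ≤ c * (3 * n) * r ^ i := by gcongr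
      _ = _ := by ring
  have hfib : ∀ b ∈ X.image (fun σ => blockCount (2 ^ j) (permGraph σ)),
      #(X.filter fun σ => blockCount (2 ^ j) (permGraph σ) = b) ≤
        ⌊Real.exp (108 * c * n) * ((2 : ℝ) ^ j) ^ n⌋₊ := by
    intro b hb
    obtain ⟨τ, hτ, rfl⟩ := mem_image.1 hb
    obtain ⟨hN1, hN2⟩ := div_two_pow_bounds hn hjJ
    refine Nat.le_floor ((card_le_exp_mul_pow_of_blockCount_eq hc0 (by positivity) hN2 τ
      (fun u hu => ?_) _ fun σ hσ => (mem_filter.1 hσ).2).trans_eq (by push_cast; rfl))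
    rw [mem_Icc] at hu
    have hu0 : (0 : ℝ) < u := Nat.cast_pos.2 hu.1
    refine hc n m (2 ^ j) u _ τ (hX τ hτ) hu.1 ((one_le_div hu0).2 (by exact_mod_cast hu.2)) ?_
    rw [mul_assoc, ← mul_pow, div_mul_cancel₀ _ hu0.ne']
    have : m ≤ (n / 2 ^ j + 1) * (2 ^ j) ^ k := by
      calc m ≤ n * (2 ^ j) ^ (k - 1) := hmj
        _ ≤ (n / 2 ^ j + 1) * 2 ^ j * (2 ^ j) ^ (k - 1) := by gcongr
        _ = _ := by rw [mul_assoc, ← pow_succ', Nat.sub_add_cancel hk.le]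
    exact_mod_cast this
  have h1 := card_le_mul_card_image X _ hfib
  have h2 := card_image_blockCount_le X (hsupp j le_rfl (by omega))
  have h3 := card_image_blockSupport_le hn X s l j
    (hl ▸ Nat.le_pow_clog (by norm_num) n) fun i hi => hsupp i hi.le
  set S := ∑ i ∈ range (l + 1), s (j + i) with hS
  have hS' : S = ∑ i ∈ range l, s (j + (i + 1)) + s j := by rw [hS, sum_range_succ', add_zero]
  have h4 : #(X.image fun σ => blockCount (2 ^ j) (permGraph σ)) ≤ 2 ^ n * 16 ^ S := by
    calc _ ≤ _ := h2
      _ ≤ 2 ^ (s j + n) * 16 ^ ∑ i ∈ range l, s (j + (i + 1)) := Nat.mul_le_mul_left _ h3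
      _ ≤ 16 ^ s j * 2 ^ n * 16 ^ ∑ i ∈ range l, s (j + (i + 1)) := by
          rw [pow_add]
          gcongr
          norm_num
      _ = _ := by rw [hS', pow_add]; ring
  have hSr : (S : ℝ) ≤ 3 * c * n * (1 - r)⁻¹ := by
    rw [hS, Nat.cast_sum]
    calc _ ≤ ∑ i ∈ range (l + 1), 3 * c * n * r ^ i := by
          refine sum_le_sum fun i _ => (Nat.floor_le (by positivity)).trans ?_
          gcongr ?_ * ?_
          exact pow_le_pow_of_le_one hr0 hr1.le (by omega)
      _ = 3 * c * n * ∑ i ∈ range (l + 1), r ^ i := by rw [mul_sum]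
      _ ≤ _ := by
          gcongr
          rw [← tsum_geometric_of_lt_one hr0 hr1]
          exact (summable_geometric_of_lt_one hr0 hr1).sum_le_tsum _ fun i _ => pow_nonneg hr0 i
  have h16 : (16 : ℝ) ^ S ≤ Real.exp (9 * c * (1 - r)⁻¹ * n) := by
    have he : (16 : ℝ) ≤ Real.exp 3 := by
      have h := Real.exp_one_gt_d9
      calc (16 : ℝ) ≤ 2.7 ^ 3 := by norm_num
        _ ≤ Real.exp 1 ^ 3 := by gcongr; linarith
        _ = Real.exp 3 := by rw [← Real.exp_nat_mul]; norm_num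
    calc (16 : ℝ) ^ S ≤ Real.exp 3 ^ S := by gcongr
      _ = Real.exp (S * 3) := by rw [Real.exp_nat_mul]
      _ ≤ _ := by
          refine Real.exp_le_exp.2 ?_
          linarith
  have h2e : (2 : ℝ) ^ n ≤ Real.exp n := by
    have h := Real.add_one_le_exp (1 : ℝ)
    rw [← mul_one (n : ℝ), Real.exp_nat_mul]
    gcongr
    linarith
  set R := max 1 (((m : ℝ) / (n : ℝ)) ^ ((n : ℝ) / ((k : ℝ) - 1)))
  have hR : 0 ≤ R := zero_le_one.trans (le_max_left _ _)
  calc (#X : ℝ) ≤ (⌊Real.exp (108 * c * n) * ((2 : ℝ) ^ j) ^ n⌋₊ : ℝ) *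
        (#(X.image fun σ => blockCount (2 ^ j) (permGraph σ)) : ℝ) := by exact_mod_cast h1
    _ ≤ (Real.exp (108 * c * n) * (2 ^ n * R)) * (2 ^ n * 16 ^ S) := by
        gcongr
        · exact (Nat.floor_le (by positivity)).trans (by gcongr)
        · exact_mod_cast h4
    _ ≤ (Real.exp (108 * c * n) * (Real.exp n * R)) *
          (Real.exp n * Real.exp (9 * c * (1 - r)⁻¹ * n)) := by gcongr
    _ = (Real.exp (108 * c * n) * Real.exp n * Real.exp n *
          Real.exp (9 * c * (1 - r)⁻¹ * n)) * R := by ring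
    _ = _ := by
        rw [← Real.exp_add, ← Real.exp_add, ← Real.exp_add]
        congr 2
        ring

/-- The number of `n`-permutations with at most `m ≤ C(n,k)` copies of `π` is at
most `exp(Cn) · max(1, (m/n)^(n/(k-1)))`. -/
theorem count_permutations_few_copies (k : ℕ) (hk : 1 < k) (π : Equiv.Perm (Fin k)) :
    ∃ C : ℝ, ∀ m n : ℕ, m ≤ Nat.choose n k →
      (Nat.card {σ : Equiv.Perm (Fin n) // permCopies π σ ≤ m} : ℝ) ≤
        Real.exp (C * n) *
          max 1 (((m : ℝ) / (n : ℝ)) ^ ((n : ℝ) / ((k : ℝ) - 1))) := by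
  classical
  obtain ⟨C, hC⟩ := exists_card_few_copies_le hk π
  refine ⟨C, fun m n hm => ?_⟩
  rcases Nat.eq_zero_or_pos n with rfl | hn
  · have h1 : Nat.card {σ : Equiv.Perm (Fin 0) // permCopies π σ ≤ m} ≤ 1 :=
      Finite.card_le_one_iff_subsingleton.2 inferInstance
    have h2 : (Nat.card {σ : Equiv.Perm (Fin 0) // permCopies π σ ≤ m} : ℝ) ≤ 1 := by
      exact_mod_cast h1
    rw [Nat.cast_zero, mul_zero, Real.exp_zero, one_mul]
    exact h2.trans (le_max_left _ _)
  · have h := hC m n (univ.filter fun σ => permCopies π σ ≤ m) hn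
      (hm.trans (Nat.choose_le_pow n k)) fun σ hσ => (mem_filter.1 hσ).2
    rwa [Nat.card_eq_fintype_card, Fintype.card_subtype]
end

section
/- Let k be an integer with k > 1 and π a permutation of {1,...,k}. For a permutation σ of {1,...,n}, let c(σ) denote the number of copies of π in σ. There exists a constant C = C(π) such that for every positive integer n and every real α with 0 < α ≤ 1, the sum over all permutations σ of {1,...,n} of (1−α)^{c(σ)} is at most exp(Cn)·α^(−n/(k−1)). (By linearity of expectation, this sum equals the expected number of permutations of {1,...,n} that Λ-avoid π when Λ is the k-uniform Erdős–Rényi random hypergraph on n vertices with edge probability α.) -/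
open Finset

/-- The copies of `π` in a finite set of cells of the grid `ℕ × ℕ`. -/
noncomputable def cellCopies {k : ℕ} (π : Equiv.Perm (Fin k)) (A : Finset (ℕ × ℕ)) :
    Finset (Fin k → ℕ × ℕ) :=
  open Classical in
  {p ∈ Fintype.piFinset fun _ => A |
    StrictMono (fun i => (p i).1) ∧ ∀ i j, π i < π j → (p i).2 < (p j).2}

theorem mem_cellCopies {k : ℕ} {π : Equiv.Perm (Fin k)} {A : Finset (ℕ × ℕ)}
    {p : Fin k → ℕ × ℕ} :
    p ∈ cellCopies π A ↔ (∀ i, p i ∈ A) ∧ StrictMono (fun i => (p i).1) ∧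
      ∀ i j, π i < π j → (p i).2 < (p j).2 := by
  simp [cellCopies]

theorem cellCopies_mono {k : ℕ} (π : Equiv.Perm (Fin k)) {A B : Finset (ℕ × ℕ)} (h : A ⊆ B) :
    cellCopies π A ⊆ cellCopies π B := fun p hp => by
  rw [mem_cellCopies] at hp ⊢
  exact ⟨fun i => h (hp.1 i), hp.2⟩

/-- The index of the `b × b` block containing a cell. -/
def cellBlock (b : ℕ) (a : ℕ × ℕ) : ℕ × ℕ := (a.1 / b, a.2 / b)

/-- The blocks of size `b × b` meeting a set of cells. -/
def contract (b : ℕ) (A : Finset (ℕ × ℕ)) : Finset (ℕ × ℕ) := A.image (cellBlock b)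

theorem contract_subset {b N : ℕ} {A : Finset (ℕ × ℕ)}
    (hA : A ⊆ range (b * N) ×ˢ range (b * N)) : contract b A ⊆ range N ×ˢ range N := by
  intro z hz
  obtain ⟨a, ha, rfl⟩ := mem_image.1 hz
  have := hA ha
  simp only [mem_product, mem_range, cellBlock] at this ⊢
  exact ⟨Nat.div_lt_of_lt_mul this.1, Nat.div_lt_of_lt_mul this.2⟩

theorem card_cellCopies_contract_le {k : ℕ} (π : Equiv.Perm (Fin k)) (b : ℕ)
    (A : Finset (ℕ × ℕ)) : #(cellCopies π (contract b A)) ≤ #(cellCopies π A) := by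
  refine (card_le_card ?_).trans (card_image_le (s := cellCopies π A)
    (f := fun p i => cellBlock b (p i)))
  intro q hq
  obtain ⟨hqA, hq1, hq2⟩ := mem_cellCopies.1 hq
  choose p hpA hp using fun i => mem_image.1 (hqA i)
  refine mem_image.2 ⟨p, mem_cellCopies.2 ⟨hpA, fun i j hij => ?_, fun i j hij => ?_⟩, funext hp⟩
  · have := hq1 hij
    simp only [← hp, cellBlock] at this
    exact Nat.lt_of_div_lt_div this
  · have := hq2 i j hij
    simp only [← hp, cellBlock] at this
    exact Nat.lt_of_div_lt_div this

theorem card_le_sq_of_cellBlock_eq {b : ℕ} (hb : 0 < b) {S : Finset (ℕ × ℕ)} {z : ℕ × ℕ}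
    (hS : ∀ a ∈ S, cellBlock b a = z) : #S ≤ b ^ 2 := by
  have : #S ≤ #(range b ×ˢ range b) := by
    refine card_le_card_of_injOn (fun a => (a.1 % b, a.2 % b)) ?_ ?_
    · intro a _
      simp [Nat.mod_lt _ hb]
    · intro a ha a' ha' h
      have h1 := hS a ha
      rw [← hS a' ha'] at h1
      simp only [cellBlock, Prod.mk.injEq] at h h1
      ext
      · rw [← Nat.div_add_mod a.1 b, h.1, h1.1, Nat.div_add_mod]
      · rw [← Nat.div_add_mod a.2 b, h.2, h1.2, Nat.div_add_mod]
  simpa [sq] using this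

theorem exists_strictMono_of_le_card {k : ℕ} {S : Finset ℕ} (h : k ≤ #S) :
    ∃ c : Fin k → ℕ, StrictMono c ∧ ∀ i, c i ∈ S :=
  ⟨fun i => S.orderEmbOfFin rfl (Fin.castLE h i),
    fun _ _ hij => (S.orderEmbOfFin rfl).strictMono (by simpa using hij),
    fun _ => orderEmbOfFin_mem _ _ _⟩

theorem mem_Ico_of_div_eq {b x y : ℕ} (hb : 0 < b) (h : x / b = y) :
    x ∈ Ico (y * b) (y * b + b) := by
  rw [Nat.div_eq_iff hb] at h
  rw [mem_Ico]
  omega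

/-- Pigeonhole: many blocks in a strip, each seeing at least `k` of the `b` lines of the strip,
contain `k` blocks seeing the same `k` lines. -/
theorem exists_common_lines {k b y : ℕ} {B : Finset ℕ} {g : ℕ → Finset ℕ}
    (hg : ∀ z ∈ B, g z ⊆ Ico (y * b) (y * b + b)) (hk : ∀ z ∈ B, k ≤ #(g z))
    (hB : k * 2 ^ b < #B) :
    ∃ c d : Fin k → ℕ, StrictMono c ∧ StrictMono d ∧ ∀ i j, d j ∈ B ∧ c i ∈ g (d j) := by
  have hmaps : ∀ z ∈ B, g z ∈ (Ico (y * b) (y * b + b)).powerset :=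
    fun z hz => mem_powerset.2 (hg z hz)
  obtain ⟨S, -, hS⟩ := exists_lt_card_fiber_of_mul_lt_card_of_maps_to (n := k) hmaps
    (by simpa [mul_comm] using hB)
  obtain ⟨d, hd, hdS⟩ := exists_strictMono_of_le_card hS.le
  have hdB : ∀ i, d i ∈ B ∧ g (d i) = S := fun i => mem_filter.1 (hdS i)
  obtain ⟨z, hz⟩ := card_pos.1 (lt_of_le_of_lt (Nat.zero_le _) hS)
  obtain ⟨hzB, hzS⟩ := mem_filter.1 hz
  obtain ⟨c, hc, hcS⟩ := exists_strictMono_of_le_card (hzS ▸ hk z hzB)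
  exact ⟨c, d, hc, hd, fun i j => ⟨(hdB j).1, (hdB j).2 ▸ hcS i⟩⟩

/-- The cells of `A` lying in the block `z`. -/
def blockCells (b : ℕ) (A : Finset (ℕ × ℕ)) (z : ℕ × ℕ) : Finset (ℕ × ℕ) :=
  {a ∈ A | cellBlock b a = z}

theorem card_wide_strip_le {k b : ℕ} (hb : 0 < b) {π : Equiv.Perm (Fin k)} {A : Finset (ℕ × ℕ)}
    (hA : cellCopies π A = ∅) (I : ℕ) {B : Finset ℕ}
    (hB : ∀ J ∈ B, k ≤ #((blockCells b A (I, J)).image Prod.fst)) : #B ≤ k * 2 ^ b := by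
  by_contra! h
  obtain ⟨c, d, hc, hd, hcd⟩ := exists_common_lines (y := I)
    (g := fun J => (blockCells b A (I, J)).image Prod.fst) (fun J _ x hx => by
      obtain ⟨a, ha, rfl⟩ := mem_image.1 hx
      exact mem_Ico_of_div_eq hb (congrArg Prod.fst (mem_filter.1 ha).2)) hB h
  choose p hp hpc using fun i => mem_image.1 (hcd i (π i)).2
  have hpA := fun i => mem_filter.1 (hp i)
  refine (eq_empty_iff_forall_notMem.1 hA) p (mem_cellCopies.2 ⟨fun i => (hpA i).1, ?_, ?_⟩)
  · simpa only [hpc] using hc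
  · intro i j hij
    have hi := congrArg Prod.snd (hpA i).2
    have hj := congrArg Prod.snd (hpA j).2
    have := hd hij
    simp only [cellBlock] at hi hj
    rw [← hi, ← hj] at this
    exact Nat.lt_of_div_lt_div this

theorem card_tall_strip_le {k b : ℕ} (hb : 0 < b) {π : Equiv.Perm (Fin k)} {A : Finset (ℕ × ℕ)}
    (hA : cellCopies π A = ∅) (J : ℕ) {B : Finset ℕ}
    (hB : ∀ I ∈ B, k ≤ #((blockCells b A (I, J)).image Prod.snd)) : #B ≤ k * 2 ^ b := by
  by_contra! h
  obtain ⟨c, d, hc, hd, hcd⟩ := exists_common_lines (y := J)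
    (g := fun I => (blockCells b A (I, J)).image Prod.snd) (fun I _ x hx => by
      obtain ⟨a, ha, rfl⟩ := mem_image.1 hx
      exact mem_Ico_of_div_eq hb (congrArg Prod.snd (mem_filter.1 ha).2)) hB h
  choose p hp hpc using fun i => mem_image.1 (hcd (π i) i).2
  have hpA := fun i => mem_filter.1 (hp i)
  refine (eq_empty_iff_forall_notMem.1 hA) p (mem_cellCopies.2 ⟨fun i => (hpA i).1, ?_, ?_⟩)
  · intro i j hij
    have hi := congrArg Prod.fst (hpA i).2
    have hj := congrArg Prod.fst (hpA j).2
    have := hd hij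
    simp only [cellBlock] at hi hj
    rw [← hi, ← hj] at this
    exact Nat.lt_of_div_lt_div this
  · intro i j hij
    rw [hpc, hpc]
    exact hc hij

theorem card_le_of_contract {k b N : ℕ} (hb : 0 < b) {π : Equiv.Perm (Fin k)}
    {A : Finset (ℕ × ℕ)} (hA : cellCopies π A = ∅)
    (hAN : A ⊆ range (b * N) ×ˢ range (b * N)) :
    #A ≤ #(contract b A) * (k - 1) ^ 2 + 2 * (N * (k * 2 ^ b) * b ^ 2) := by
  set B := contract b A
  have hBN : B ⊆ range N ×ˢ range N := contract_subset hAN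
  set W := {z ∈ B | k ≤ #((blockCells b A z).image Prod.fst)}
  set T := {z ∈ B | k ≤ #((blockCells b A z).image Prod.snd)}
  have hW : #W ≤ N * (k * 2 ^ b) := by
    have := card_le_mul_card_image_of_maps_to (s := W) (t := range N) (f := Prod.fst)
      (fun z hz => (mem_product.1 (hBN (mem_filter.1 hz).1)).1) (k * 2 ^ b) (fun I _ => by
        rw [← card_image_of_injOn (f := Prod.snd)]
        · refine card_wide_strip_le hb hA I fun J hJ => ?_
          obtain ⟨⟨I', J'⟩, hz, rfl⟩ := mem_image.1 hJ
          obtain ⟨hzW, rfl⟩ := mem_filter.1 hz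
          exact (mem_filter.1 hzW).2
        · intro z hz z' hz' h
          exact Prod.ext ((mem_filter.1 hz).2.trans (mem_filter.1 hz').2.symm) h)
    simpa [mul_comm] using this
  have hT : #T ≤ N * (k * 2 ^ b) := by
    have := card_le_mul_card_image_of_maps_to (s := T) (t := range N) (f := Prod.snd)
      (fun z hz => (mem_product.1 (hBN (mem_filter.1 hz).1)).2) (k * 2 ^ b) (fun J _ => by
        rw [← card_image_of_injOn (f := Prod.fst)]
        · refine card_tall_strip_le hb hA J fun I hI => ?_
          obtain ⟨⟨I', J'⟩, hz, rfl⟩ := mem_image.1 hI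
          obtain ⟨hzT, rfl⟩ := mem_filter.1 hz
          exact (mem_filter.1 hzT).2
        · intro z hz z' hz' h
          exact Prod.ext h ((mem_filter.1 hz).2.trans (mem_filter.1 hz').2.symm))
    simpa [mul_comm] using this
  have hsum : #A = ∑ z ∈ B, #(blockCells b A z) :=
    card_eq_sum_card_fiberwise fun a ha => mem_image_of_mem _ ha
  have hle : ∀ z ∈ B, #(blockCells b A z) ≤ (k - 1) ^ 2 +
      ((if k ≤ #((blockCells b A z).image Prod.fst) then b ^ 2 else 0) +
        (if k ≤ #((blockCells b A z).image Prod.snd) then b ^ 2 else 0)) := by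
    intro z _
    have h1 : #(blockCells b A z) ≤ b ^ 2 :=
      card_le_sq_of_cellBlock_eq hb fun a ha => (mem_filter.1 ha).2
    split_ifs with hw ht ht
    · omega
    · omega
    · omega
    · have h2 := card_le_card (subset_product (s := blockCells b A z))
      rw [card_product] at h2
      refine h2.trans ?_
      rw [sq]
      exact Nat.mul_le_mul (by omega) (by omega)
  calc #A ≤ _ := hsum ▸ sum_le_sum hle
    _ = #B * (k - 1) ^ 2 + (#W * b ^ 2 + #T * b ^ 2) := by
      rw [sum_add_distrib, sum_add_distrib, ← sum_filter, ← sum_filter]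
      simp [W, T]
    _ ≤ _ := by
      have h1 := Nat.mul_le_mul_right (b ^ 2) hW
      have h2 := Nat.mul_le_mul_right (b ^ 2) hT
      omega

/-- The Marcus–Tardos theorem on grids whose side is a power of `k ^ 2`. -/
theorem marcus_tardos {k : ℕ} (hk : 1 < k) (π : Equiv.Perm (Fin k)) :
    ∃ c : ℕ, ∀ L : ℕ, ∀ A ⊆ range ((k ^ 2) ^ L) ×ˢ range ((k ^ 2) ^ L),
      cellCopies π A = ∅ → #A ≤ c * (k ^ 2) ^ L := by
  set D := 2 * ((k * 2 ^ k ^ 2) * (k ^ 2) ^ 2) with hD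
  have hD0 : 1 ≤ D := Nat.succ_le_of_lt (by positivity)
  refine ⟨D, fun L => ?_⟩
  induction L with
  | zero =>
    intro A hA _
    have := card_le_card hA
    simp at this ⊢
    omega
  | succ L ih =>
    intro A hA hc
    rw [pow_succ'] at hA
    have h1 := card_le_of_contract (by positivity) hc hA
    have h2 := ih _ (contract_subset hA) (by
      have := card_cellCopies_contract_le π (k ^ 2) A
      rw [hc] at this
      simpa using this)
    obtain ⟨m, rfl⟩ : ∃ m, k = m + 1 := ⟨k - 1, by omega⟩
    simp only [Nat.add_sub_cancel] at h1
    set N := ((m + 1) ^ 2) ^ L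
    calc #A ≤ _ := h1
      _ ≤ (D * N) * m ^ 2 + D * N := by
        refine Nat.add_le_add (Nat.mul_le_mul_right _ h2) (le_of_eq ?_)
        rw [hD]; ring
      _ ≤ D * ((m + 1) ^ 2 * N) := by
        have : (D * N) * (m ^ 2 + 1) ≤ (D * N) * (m + 1) ^ 2 :=
          Nat.mul_le_mul_left _ (by nlinarith)
        linarith
      _ = _ := by rw [pow_succ' ((m + 1) ^ 2) L]

theorem card_le_add_card_cellCopies {k M : ℕ} (hk : 0 < k) {π : Equiv.Perm (Fin k)}
    (A : Finset (ℕ × ℕ)) (h : ∀ B ⊆ A, cellCopies π B = ∅ → #B ≤ M) :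
    #A ≤ M + #(cellCopies π A) := by
  induction A using Finset.strongInduction with
  | H A ih =>
    rcases (cellCopies π A).eq_empty_or_nonempty with h0 | ⟨p, hp⟩
    · have := h A subset_rfl h0
      omega
    · have hpA := (mem_cellCopies.1 hp).1 ⟨0, hk⟩
      have h1 := ih _ (erase_ssubset hpA) fun B hB => h B (hB.trans (erase_subset _ _))
      have h2 : cellCopies π (A.erase (p ⟨0, hk⟩)) ⊂ cellCopies π A := by
        refine (cellCopies_mono π (erase_subset _ _)).ssubset_of_ne fun h => ?_
        rw [← h] at hp
        exact notMem_erase _ _ ((mem_cellCopies.1 hp).1 ⟨0, hk⟩)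
      have h3 := card_lt_card h2
      have h4 := card_erase_add_one hpA
      omega

/-- The proportion of `q`-colorings for which a fixed `k`-tuple of distinct points is monochromatic
is `q ^ (1 - k)`. -/
theorem card_monochromatic_mul {V : Type*} [Fintype V] [DecidableEq V] {k : ℕ} (hk : 0 < k)
    (q : ℕ) {x : Fin k → V} (hx : Function.Injective x) :
    #{χ : V → Fin q | ∀ i j, χ (x i) = χ (x j)} * q ^ (k - 1) = q ^ Fintype.card V := by
  have hS : #(univ.image x) = k := by simp [card_image_of_injective _ hx]
  have hkV : k ≤ Fintype.card V := by simpa using Fintype.card_le_of_injective x hx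
  have h1 : ({χ : V → Fin q | ∀ i j, χ (x i) = χ (x j)} : Finset (V → Fin q)) =
      univ.biUnion fun c => Fintype.piFinset fun v => if v ∈ univ.image x then {c} else univ := by
    ext χ
    simp only [mem_filter, mem_univ, true_and, mem_biUnion, Fintype.mem_piFinset]
    constructor
    · refine fun h => ⟨χ (x ⟨0, hk⟩), fun v => ?_⟩
      split_ifs with hv
      · obtain ⟨i, -, rfl⟩ := mem_image.1 hv
        simpa using h _ _
      · exact mem_univ _
    · rintro ⟨c, hc⟩ i j
      have : ∀ i, χ (x i) = c := fun i => by simpa using hc (x i)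
      rw [this, this]
  have h2 : ∀ c : Fin q,
      #(Fintype.piFinset fun v => if v ∈ univ.image x then {c} else (univ : Finset (Fin q))) =
        q ^ (Fintype.card V - k) := by
    intro c
    rw [Fintype.card_piFinset]
    simp only [apply_ite card, card_singleton, card_univ, Fintype.card_fin]
    rw [prod_ite, prod_const_one, one_mul, prod_const, filter_not, card_sdiff]
    simp [hS]
  rw [h1, card_biUnion]
  · simp only [h2, sum_const, card_univ, Fintype.card_fin, smul_eq_mul]
    rw [mul_right_comm, ← pow_succ', Nat.sub_add_cancel hk, ← pow_add, Nat.add_sub_cancel' hkV]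
  · intro c _ c' _ hcc
    rw [Function.onFun, disjoint_left]
    intro χ h h'
    rw [Fintype.mem_piFinset] at h h'
    have := h (x ⟨0, hk⟩)
    have := h' (x ⟨0, hk⟩)
    simp_all

/-- Supersaturation, by coloring the columns at random. -/
theorem card_mul_le_of_coloring {k M N q : ℕ} (hk : 1 < k) (hq : 0 < q) {π : Equiv.Perm (Fin k)}
    {A : Finset (ℕ × ℕ)} (hA : ∀ a ∈ A, a.1 < N)
    (h : ∀ B ⊆ A, cellCopies π B = ∅ → #B ≤ M) :
    #A * q ≤ q ^ 2 * M + #(cellCopies π A) := by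
  classical
  rcases N.eq_zero_or_pos with rfl | hN
  · have : A = ∅ := eq_empty_of_forall_notMem fun a ha => absurd (hA a ha) (by omega)
    simp [this]
  have : NeZero N := ⟨hN.ne'⟩
  have hk0 : 0 < k := by omega
  let col : ℕ × ℕ → Fin N := fun a => Fin.ofNat N a.1
  have hcol : ∀ a ∈ A, (col a : ℕ) = a.1 := fun a ha => Nat.mod_eq_of_lt (hA a ha)
  have h1 : ∀ χ : Fin N → Fin q,
      #A ≤ q * M + #{p ∈ cellCopies π A | ∀ i j, χ (col (p i)) = χ (col (p j))} := by
    intro χ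
    have e1 : #A = ∑ c : Fin q, #{a ∈ A | χ (col a) = c} :=
      card_eq_sum_card_fiberwise fun a _ => mem_univ _
    have e2 : ∑ c : Fin q, #(cellCopies π {a ∈ A | χ (col a) = c}) ≤
        #{p ∈ cellCopies π A | ∀ i j, χ (col (p i)) = χ (col (p j))} := by
      rw [← card_biUnion]
      · refine card_le_card fun p hp => ?_
        obtain ⟨c, -, hp⟩ := mem_biUnion.1 hp
        refine mem_filter.2 ⟨cellCopies_mono π (filter_subset _ _) hp, fun i j => ?_⟩
        have := fun i => (mem_filter.1 ((mem_cellCopies.1 hp).1 i)).2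
        rw [this, this]
      · intro c _ c' _ hcc
        rw [Function.onFun, disjoint_left]
        intro p hp hp'
        refine hcc ?_
        rw [← (mem_filter.1 ((mem_cellCopies.1 hp).1 ⟨0, hk0⟩)).2,
          (mem_filter.1 ((mem_cellCopies.1 hp').1 ⟨0, hk0⟩)).2]
    have e3 : ∀ c : Fin q, #{a ∈ A | χ (col a) = c} ≤
        M + #(cellCopies π {a ∈ A | χ (col a) = c}) := fun c =>
      card_le_add_card_cellCopies hk0 _ fun B hB => h B (hB.trans (filter_subset _ _))
    have e4 := sum_le_sum fun c (_ : c ∈ univ) => e3 c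
    rw [sum_add_distrib, ← e1] at e4
    simp only [sum_const, card_univ, Fintype.card_fin, smul_eq_mul] at e4
    omega
  have h2 := sum_le_sum fun χ (_ : χ ∈ univ) => h1 χ
  rw [sum_add_distrib] at h2
  simp only [sum_const, card_univ, Fintype.card_fin, smul_eq_mul, Fintype.card_fun] at h2
  have h3 : (∑ χ : Fin N → Fin q,
      #{p ∈ cellCopies π A | ∀ i j, χ (col (p i)) = χ (col (p j))}) * q ^ (k - 1) =
        #(cellCopies π A) * q ^ N := by
    simp only [card_filter]
    rw [sum_comm, sum_mul, card_eq_sum_ones, sum_mul]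
    refine sum_congr rfl fun p hp => ?_
    rw [← card_filter]
    obtain ⟨hpA, hp, -⟩ := mem_cellCopies.1 hp
    have := card_monochromatic_mul hk0 q (x := fun i => col (p i)) (fun i j hij => by
      refine hp.injective ?_
      simpa only [hcol _ (hpA _)] using congrArg Fin.val hij)
    rw [one_mul, this, Fintype.card_fin]
  have h4 : #A * q ^ (k - 1) ≤ q * M * q ^ (k - 1) + #(cellCopies π A) := by
    have := Nat.mul_le_mul_right (q ^ (k - 1)) h2
    rw [add_mul, h3] at this
    refine le_of_mul_le_mul_left (a := q ^ N) ?_ (by positivity)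
    linarith
  obtain ⟨m, rfl⟩ : ∃ m, k = m + 2 := ⟨k - 2, by omega⟩
  rcases le_total (#A) (q * M) with hle | hle
  · nlinarith
  · obtain ⟨d, hd⟩ := Nat.exists_eq_add_of_le hle
    rw [hd, add_mul] at h4 ⊢
    have : d * q ≤ d * q ^ (m + 2 - 1) :=
      Nat.mul_le_mul_left _ (Nat.le_self_pow (by omega) _)
    nlinarith

/-- The total number of nonempty blocks of a set of cells at the scales `b, b ^ 2, …, b ^ J`. -/
def blockWeight (b : ℕ) : ℕ → Finset (ℕ × ℕ) → ℕ
  | 0, _ => 0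
  | J + 1, A => #(contract b A) + blockWeight b J (contract b A)

theorem blockWeight_mul_le {k c : ℕ} (hk : 1 < k) {π : Equiv.Perm (Fin k)}
    (hc : ∀ L : ℕ, ∀ A ⊆ range ((k ^ 2) ^ L) ×ˢ range ((k ^ 2) ^ L),
      cellCopies π A = ∅ → #A ≤ c * (k ^ 2) ^ L) (J s : ℕ) (A : Finset (ℕ × ℕ))
    (hA : A ⊆ range ((k ^ 2) ^ J) ×ˢ range ((k ^ 2) ^ J)) :
    blockWeight (k ^ 2) J A * k ^ s ≤ c * k ^ (2 * s) * (k ^ 2) ^ J + #(cellCopies π A) := by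
  induction J generalizing s A with
  | zero => simp [blockWeight]
  | succ J ih =>
    rw [pow_succ'] at hA
    have hB := contract_subset hA
    have h1 := ih (s + 1) _ hB
    have h2 := card_mul_le_of_coloring hk (q := k ^ (s + 1)) (by positivity)
      (fun a ha => mem_range.1 (mem_product.1 (hB ha)).1)
      (fun B hBA => hc J B (hBA.trans hB))
    have h3 := card_cellCopies_contract_le π (k ^ 2) A
    rw [blockWeight]
    refine le_of_mul_le_mul_left (a := k) ?_ (by omega)
    set X := #(cellCopies π A)
    set B := contract (k ^ 2) A
    have e1 : c * k ^ (2 * (s + 1)) * (k ^ 2) ^ J = c * k ^ (2 * s) * (k ^ 2) ^ (J + 1) := by ring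
    have e2 : (k ^ (s + 1)) ^ 2 * (c * (k ^ 2) ^ J) = c * k ^ (2 * s) * (k ^ 2) ^ (J + 1) := by
      ring
    rw [e1] at h1
    rw [e2] at h2
    calc k * ((#B + blockWeight (k ^ 2) J B) * k ^ s)
        = #B * k ^ (s + 1) + blockWeight (k ^ 2) J B * k ^ (s + 1) := by ring
      _ ≤ 2 * (c * k ^ (2 * s) * (k ^ 2) ^ (J + 1) + X) := by linarith
      _ ≤ _ := Nat.mul_le_mul_right _ hk

theorem card_contract_fiber_le {b : ℕ} (hb : 0 < b) (F : Finset (Finset (ℕ × ℕ)))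
    (B : Finset (ℕ × ℕ)) : #{A ∈ F | contract b A = B} ≤ (2 ^ b ^ 2) ^ #B := by
  set P : Finset (ℕ × ℕ) :=
    (B ×ˢ (range b ×ˢ range b)).image fun z => (z.1.1 * b + z.2.1, z.1.2 * b + z.2.2)
  have hP : #P ≤ b ^ 2 * #B := by
    refine card_image_le.trans (le_of_eq ?_)
    simp only [card_product, card_range]
    ring
  calc _ ≤ #P.powerset := by
        refine card_le_card fun A hA => mem_powerset.2 fun a ha => ?_
        obtain ⟨-, rfl⟩ := mem_filter.1 hA
        refine mem_image.2 ⟨(cellBlock b a, (a.1 % b, a.2 % b)), ?_, ?_⟩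
        · exact mem_product.2 ⟨mem_image_of_mem _ ha, by simp [Nat.mod_lt _ hb]⟩
        · simp [cellBlock, Nat.div_add_mod']
    _ ≤ 2 ^ (b ^ 2 * #B) := by
        rw [card_powerset]
        exact Nat.pow_le_pow_right (by norm_num) hP
    _ = _ := pow_mul _ _ _

/-- A Kraft-type inequality for the encoding of a set of cells by its successive contractions. -/
theorem sum_pow_blockWeight_le {b : ℕ} (hb : 0 < b) (J : ℕ) :
    ∑ A ∈ (range (b ^ J) ×ˢ range (b ^ J)).powerset,
      ((2 ^ b ^ 2 : ℝ)⁻¹) ^ blockWeight b J A ≤ 2 := by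
  induction J with
  | zero => simp [blockWeight]
  | succ J ih =>
    refine le_trans ?_ ih
    rw [← sum_fiberwise_of_maps_to (g := contract b)
      (t := (range (b ^ J) ×ˢ range (b ^ J)).powerset)]
    · refine sum_le_sum fun B _ => ?_
      rw [sum_congr rfl (g := fun _ => ((2 ^ b ^ 2 : ℝ)⁻¹) ^ (#B + blockWeight b J B))
        (fun A hA => by rw [blockWeight, (mem_filter.1 hA).2]), sum_const, nsmul_eq_mul,
        pow_add _ (#B), ← mul_assoc]
      refine mul_le_of_le_one_left (by positivity) ?_
      rw [inv_pow]
      refine mul_inv_le_one_of_le₀ ?_ (by positivity)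
      exact_mod_cast card_contract_fiber_le hb _ B
    · intro A hA
      rw [mem_powerset, pow_succ'] at hA
      exact mem_powerset.2 (contract_subset hA)

/-- The graph of a permutation, as a set of cells. -/
def permCells {n : ℕ} (σ : Equiv.Perm (Fin n)) : Finset (ℕ × ℕ) :=
  univ.image fun i : Fin n => ((i : ℕ), (σ i : ℕ))

theorem permCells_injective {n : ℕ} :
    Function.Injective (permCells : Equiv.Perm (Fin n) → Finset (ℕ × ℕ)) := by
  intro σ τ h
  ext i
  have : ((i : ℕ), (σ i : ℕ)) ∈ permCells τ := h ▸ mem_image_of_mem _ (mem_univ i)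
  obtain ⟨j, -, hj⟩ := mem_image.1 this
  simp only [Prod.mk.injEq] at hj
  rw [← hj.2, Fin.ext hj.1]

theorem card_cellCopies_permCells_le {k n : ℕ} (π : Equiv.Perm (Fin k))
    (σ : Equiv.Perm (Fin n)) : #(cellCopies π (permCells σ)) ≤ permCopies π σ := by
  classical
  rw [permCopies, Nat.card_eq_fintype_card, Fintype.card_subtype]
  refine (card_le_card ?_).trans (card_image_le
    (f := fun (x : Fin k → Fin n) i => ((x i : ℕ), (σ (x i) : ℕ))))
  intro p hp
  obtain ⟨hpA, hp1, hp2⟩ := mem_cellCopies.1 hp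
  choose x _ hx using fun i => mem_image.1 (hpA i)
  have hlt : ∀ i j, π i < π j → σ (x i) < σ (x j) := fun i j hij => by
    have := hp2 i j hij
    simpa only [← hx, Fin.val_fin_lt] using this
  refine mem_image.2 ⟨x, mem_filter.2 ⟨mem_univ _, fun i j hij => ?_, fun i j => ⟨hlt i j, ?_⟩⟩,
    funext hx⟩
  · have := hp1 hij
    simpa only [← hx, Fin.val_fin_lt] using this
  · intro h
    by_contra hij
    rcases (not_lt.1 hij).lt_or_eq with h' | h'
    · exact lt_asymm h (hlt j i h')
    · rw [π.injective h'] at h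
      exact lt_irrefl _ h

/-- The case of a constant edge probability. -/
theorem exists_sum_pow_permCopies_le {k : ℕ} (hk : 1 < k) (π : Equiv.Perm (Fin k)) :
    ∃ L K : ℝ, 1 ≤ L ∧ 1 ≤ K ∧ ∀ n : ℕ,
      ∑ σ : Equiv.Perm (Fin n), Real.exp (-L * permCopies π σ) ≤ K ^ n := by
  obtain ⟨c, hc⟩ := marcus_tardos hk π
  set b := k ^ 2 with hb
  have hb1 : 1 < b := Nat.one_lt_pow (by norm_num) hk
  set β : ℝ := (2 ^ (b ^ 2))⁻¹ with hβ
  have hβ0 : 0 < β := by positivity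
  have hβ1 : β ≤ 1 := inv_le_one_of_one_le₀ (one_le_pow₀ (by norm_num))
  have hexp : ∀ m : ℕ, Real.exp (-(b : ℝ) ^ 2 * m) ≤ β ^ m := by
    intro m
    rw [mul_comm, Real.exp_nat_mul, hβ, Real.exp_neg]
    refine pow_le_pow_left₀ (by positivity) ?_ _
    refine inv_anti₀ (by positivity) ?_
    have h2 : (2 : ℝ) ≤ Real.exp 1 := by
      have := Real.add_one_le_exp (1 : ℝ)
      linarith
    calc (2 : ℝ) ^ b ^ 2 ≤ Real.exp 1 ^ b ^ 2 := pow_le_pow_left₀ (by norm_num) h2 _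
      _ = Real.exp ((b : ℝ) ^ 2) := by rw [← Real.exp_nat_mul]; simp
  have hβi : 1 ≤ β⁻¹ := (one_le_inv₀ hβ0).2 hβ1
  have hK : 1 ≤ 2 * β⁻¹ ^ (c * b) := by
    have := one_le_pow₀ hβi (n := c * b)
    linarith
  refine ⟨(b : ℝ) ^ 2, 2 * β⁻¹ ^ (c * b), one_le_pow₀ (by exact_mod_cast hb1.le), hK,
    fun n => ?_⟩
  rcases n.eq_zero_or_pos with rfl | hn
  · simp only [univ_unique, sum_singleton, pow_zero]
    exact (hexp _).trans (pow_le_one₀ hβ0.le hβ1)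
  obtain ⟨J, hnJ, hJn⟩ : ∃ J, n ≤ b ^ J ∧ b ^ J ≤ b * n := by
    refine ⟨Nat.clog b n, Nat.le_pow_clog hb1 n, ?_⟩
    rcases Nat.lt_or_ge 1 n with h1 | h1
    · have := Nat.pow_pred_clog_lt_self hb1 h1
      have hpos := Nat.clog_pos hb1 h1
      obtain ⟨l, hl⟩ : ∃ l, Nat.clog b n = l + 1 := ⟨Nat.clog b n - 1, by omega⟩
      rw [hl] at this ⊢
      rw [pow_succ']
      exact Nat.mul_le_mul_left _ this.le
    · rw [Nat.clog_of_right_le_one h1, pow_zero]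
      nlinarith
  have hsub : ∀ σ : Equiv.Perm (Fin n), permCells σ ⊆ range (b ^ J) ×ˢ range (b ^ J) := by
    intro σ a ha
    obtain ⟨i, -, rfl⟩ := mem_image.1 ha
    exact mem_product.2 ⟨mem_range.2 (i.2.trans_le hnJ), mem_range.2 ((σ i).2.trans_le hnJ)⟩
  have hterm : ∀ σ : Equiv.Perm (Fin n), Real.exp (-(b : ℝ) ^ 2 * permCopies π σ) ≤
      β⁻¹ ^ (c * b ^ J) * β ^ blockWeight b J (permCells σ) := by
    intro σ
    have h1 := blockWeight_mul_le hk hc J 0 _ (hsub σ)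
    simp only [mul_zero, pow_zero, mul_one, ← hb] at h1
    have h2 := card_cellCopies_permCells_le π σ
    refine (hexp _).trans ?_
    rw [inv_pow β (c * b ^ J), inv_mul_eq_div, le_div_iff₀ (by positivity), ← pow_add]
    exact pow_le_pow_of_le_one hβ0.le hβ1 (by linarith)
  calc _ ≤ ∑ σ : Equiv.Perm (Fin n), β⁻¹ ^ (c * b ^ J) * β ^ blockWeight b J (permCells σ) :=
        sum_le_sum fun σ _ => hterm σ
    _ = β⁻¹ ^ (c * b ^ J) * ∑ A ∈ univ.image (permCells (n := n)), β ^ blockWeight b J A := by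
        rw [← mul_sum, sum_image permCells_injective.injOn]
    _ ≤ β⁻¹ ^ (c * (b * n)) * 2 := by
        refine mul_le_mul ?_ ?_ (by positivity) (by positivity)
        · exact pow_le_pow_right₀ hβi (Nat.mul_le_mul_left _ hJn)
        · refine le_trans (sum_le_sum_of_subset_of_nonneg ?_ fun _ _ _ => by positivity)
            (sum_pow_blockWeight_le (zero_lt_one.trans hb1) J)
          intro A hA
          obtain ⟨σ, -, rfl⟩ := mem_image.1 hA
          exact mem_powerset.2 (hsub σ)
    _ ≤ (2 * β⁻¹ ^ (c * b)) ^ n := by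
        rw [mul_pow, ← pow_mul, mul_assoc c b n, mul_comm]
        refine mul_le_mul_of_nonneg_right ?_ (by positivity)
        exact le_self_pow₀ (by norm_num) hn.ne'

/-- The number of copies of `π` in a bijection between linear orders. -/
noncomputable def equivCopies {k : ℕ} (π : Equiv.Perm (Fin k)) {α β : Type*} [Preorder α]
    [Preorder β] (e : α ≃ β) : ℕ :=
  Nat.card {x : Fin k → α // StrictMono x ∧ ∀ i j, π i < π j ↔ e (x i) < e (x j)}

theorem equivCopies_equivCongr {k : ℕ} (π : Equiv.Perm (Fin k)) {α β α' β' : Type*} [Preorder α]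
    [Preorder β] [Preorder α'] [Preorder β'] (f : α ≃o α') (g : β ≃o β') (e : α ≃ β) :
    equivCopies π (f.toEquiv.equivCongr g.toEquiv e) = equivCopies π e := by
  refine Nat.card_congr (Equiv.subtypeEquiv (Equiv.arrowCongr (Equiv.refl _) f.symm.toEquiv) ?_)
  intro x
  refine and_congr ?_ (forall₂_congr fun i j => iff_congr Iff.rfl ?_)
  · exact forall₂_congr fun i j => imp_congr Iff.rfl (f.symm.lt_iff_lt (x := x i) (y := x j)).symm
  · exact g.lt_iff_lt

theorem sum_exp_equivCopies_le {k : ℕ} {π : Equiv.Perm (Fin k)} {L K : ℝ} (hK : 0 ≤ K)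
    (h : ∀ n : ℕ, ∑ σ : Equiv.Perm (Fin n), Real.exp (-L * permCopies π σ) ≤ K ^ n)
    (α β : Type*) [Fintype α] [Fintype β] [LinearOrder α] [LinearOrder β] :
    ∑ e : α ≃ β, Real.exp (-L * equivCopies π e) ≤ K ^ Fintype.card α := by
  rcases isEmpty_or_nonempty (α ≃ β) with hE | ⟨⟨e⟩⟩
  · simp only [univ_eq_empty, sum_empty]
    positivity
  · have f : Fin (Fintype.card α) ≃o α := Fintype.orderIsoFinOfCardEq α rfl
    have g : Fin (Fintype.card α) ≃o β := Fintype.orderIsoFinOfCardEq β (Fintype.card_congr e).symm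
    rw [← Equiv.sum_comp (f.toEquiv.equivCongr g.toEquiv)]
    simp only [equivCopies_equivCongr]
    exact h _

theorem sum_equivCopies_subtype_le {k n q : ℕ} (hk : 0 < k) (π : Equiv.Perm (Fin k))
    (σ : Equiv.Perm (Fin n)) (χ ρ : Fin n → Fin q) (h : ∀ a, χ a = ρ (σ a)) :
    ∑ c, equivCopies π (σ.subtypeEquiv (p := fun a => χ a = c) (q := fun a => ρ a = c)
        (fun a => by rw [h])) ≤
      Nat.card {x : Fin k → Fin n // (StrictMono x ∧ ∀ i j, π i < π j ↔ σ (x i) < σ (x j)) ∧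
        ∀ i j, χ (x i) = χ (x j)} := by
  simp only [equivCopies]
  rw [← Nat.card_sigma]
  refine Nat.card_le_card_of_injective
    (fun y => ⟨fun i => (y.2.1 i).1, ⟨y.2.2.1, y.2.2.2⟩, fun i j => ?_⟩) ?_
  · rw [(y.2.1 i).2, (y.2.1 j).2]
  · rintro ⟨c, x, hx⟩ ⟨c', x', hx'⟩ hxx
    have hval : ∀ i, (x i).1 = (x' i).1 := fun i => congrFun (congrArg Subtype.val hxx) i
    obtain rfl : c = c' := by
      rw [← (x ⟨0, hk⟩).2, ← (x' ⟨0, hk⟩).2, hval]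
    obtain rfl : x = x' := funext fun i => Subtype.ext (hval i)
    rfl

theorem sum_exp_monochromatic_le {k n q : ℕ} (hk : 0 < k) {π : Equiv.Perm (Fin k)} {L K : ℝ}
    (hL : 0 ≤ L) (hK : 0 ≤ K)
    (h : ∀ n : ℕ, ∑ σ : Equiv.Perm (Fin n), Real.exp (-L * permCopies π σ) ≤ K ^ n)
    (χ : Fin n → Fin q) :
    ∑ σ : Equiv.Perm (Fin n), Real.exp (-L * Nat.card {x : Fin k → Fin n //
      (StrictMono x ∧ ∀ i j, π i < π j ↔ σ (x i) < σ (x j)) ∧ ∀ i j, χ (x i) = χ (x j)}) ≤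
        q ^ n * K ^ n := by
  classical
  rw [← sum_fiberwise (g := fun σ : Equiv.Perm (Fin n) => χ ∘ σ.symm)]
  have hfib : ∀ ρ : Fin n → Fin q, ∑ σ : Equiv.Perm (Fin n) with χ ∘ σ.symm = ρ,
      Real.exp (-L * Nat.card {x : Fin k → Fin n //
        (StrictMono x ∧ ∀ i j, π i < π j ↔ σ (x i) < σ (x j)) ∧ ∀ i j, χ (x i) = χ (x j)}) ≤
          K ^ n := by
    intro ρ
    have hρ : ∀ σ ∈ ({σ | χ ∘ σ.symm = ρ} : Finset (Equiv.Perm (Fin n))),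
        ∀ a, χ a = ρ (σ a) := by
      intro σ hσ a
      rw [← (mem_filter.1 hσ).2]
      simp
    let F : ∀ σ ∈ ({σ | χ ∘ σ.symm = ρ} : Finset (Equiv.Perm (Fin n))),
        ∀ c : Fin q, {a // χ a = c} ≃ {a // ρ a = c} := fun σ hσ c =>
      σ.subtypeEquiv (fun a => by rw [hρ σ hσ])
    calc _ = ∑ σ ∈ ({σ | χ ∘ σ.symm = ρ} : Finset (Equiv.Perm (Fin n))).attach,
          Real.exp (-L * Nat.card {x : Fin k → Fin n //
            (StrictMono x ∧ ∀ i j, π i < π j ↔ σ.1 (x i) < σ.1 (x j)) ∧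
              ∀ i j, χ (x i) = χ (x j)}) := (sum_attach _ _).symm
      _ ≤ ∑ σ ∈ ({σ | χ ∘ σ.symm = ρ} : Finset (Equiv.Perm (Fin n))).attach,
          ∏ c, Real.exp (-L * equivCopies π (F σ.1 σ.2 c)) := by
        refine sum_le_sum fun σ _ => ?_
        rw [← Real.exp_sum, ← mul_sum]
        refine Real.exp_le_exp.2 (mul_le_mul_of_nonpos_left ?_ (by linarith))
        exact_mod_cast sum_equivCopies_subtype_le hk π σ.1 χ ρ (hρ σ.1 σ.2)
      _ = ∑ e ∈ ({σ | χ ∘ σ.symm = ρ} : Finset (Equiv.Perm (Fin n))).attach.image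
            (fun σ => F σ.1 σ.2), ∏ c, Real.exp (-L * equivCopies π (e c)) := by
        rw [sum_image]
        intro σ _ τ _ hστ
        refine Subtype.ext (Equiv.ext fun a => ?_)
        exact congrArg Subtype.val (DFunLike.congr_fun (congrFun hστ (χ a)) ⟨a, rfl⟩)
      _ ≤ ∑ e : ∀ c : Fin q, {a // χ a = c} ≃ {a // ρ a = c},
            ∏ c, Real.exp (-L * equivCopies π (e c)) :=
        sum_le_sum_of_subset_of_nonneg (subset_univ _) fun _ _ _ => by positivity
      _ = ∏ c : Fin q, ∑ e : {a // χ a = c} ≃ {a // ρ a = c},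
            Real.exp (-L * equivCopies π e) := by
        rw [Fintype.prod_sum]
      _ ≤ ∏ c : Fin q, K ^ Fintype.card {a // χ a = c} :=
        prod_le_prod (fun _ _ => sum_nonneg fun _ _ => by positivity)
          fun c _ => sum_exp_equivCopies_le hK h _ _
      _ = K ^ n := by
        rw [prod_pow_eq_pow_sum, ← Fintype.card_sigma,
          Fintype.card_congr (Equiv.sigmaFiberEquiv χ), Fintype.card_fin]
  refine (sum_le_sum fun ρ _ => hfib ρ).trans (le_of_eq ?_)
  simp

/-- Jensen's inequality over a uniformly random `q`-coloring of the positions. -/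
theorem exp_permCopies_le {k n q : ℕ} (hk : 0 < k) (hq : 0 < q) (π : Equiv.Perm (Fin k)) (L : ℝ)
    (σ : Equiv.Perm (Fin n)) :
    (q : ℝ) ^ n * Real.exp (-(L / q ^ (k - 1)) * permCopies π σ) ≤
      ∑ χ : Fin n → Fin q, Real.exp (-L * Nat.card {x : Fin k → Fin n //
        (StrictMono x ∧ ∀ i j, π i < π j ↔ σ (x i) < σ (x j)) ∧ ∀ i j, χ (x i) = χ (x j)}) := by
  classical
  set m : (Fin n → Fin q) → ℕ := fun χ => Nat.card {x : Fin k → Fin n //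
    (StrictMono x ∧ ∀ i j, π i < π j ↔ σ (x i) < σ (x j)) ∧ ∀ i j, χ (x i) = χ (x j)} with hm
  have hsum : (∑ χ, m χ) * q ^ (k - 1) = permCopies π σ * q ^ n := by
    set S : Finset (Fin k → Fin n) :=
      {x | StrictMono x ∧ ∀ i j, π i < π j ↔ σ (x i) < σ (x j)} with hS
    have hmS : ∀ χ, m χ = ∑ x ∈ S, if ∀ i j, χ (x i) = χ (x j) then 1 else 0 := by
      intro χ
      simp only [hm]
      rw [Nat.card_eq_fintype_card, Fintype.card_subtype, ← card_filter, hS, filter_filter]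
    rw [permCopies, Nat.card_eq_fintype_card, Fintype.card_subtype, ← hS, card_eq_sum_ones,
      sum_congr rfl fun χ _ => hmS χ, sum_comm, sum_mul, sum_mul]
    refine sum_congr rfl fun x hx => ?_
    rw [← card_filter, card_monochromatic_mul hk q (mem_filter.1 hx).2.1.injective, one_mul,
      Fintype.card_fin]
  have hq' : (0 : ℝ) < q := by exact_mod_cast hq
  have hsum' : (∑ χ, (m χ : ℝ)) = permCopies π σ * q ^ n / q ^ (k - 1) := by
    rw [eq_div_iff (by positivity)]
    exact_mod_cast hsum
  have hJ := convexOn_exp.map_sum_le (t := (univ : Finset (Fin n → Fin q)))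
    (w := fun _ => ((q : ℝ) ^ n)⁻¹) (p := fun χ => -L * m χ) (fun _ _ => by positivity)
    (by simp [hq'.ne']) (fun _ _ => Set.mem_univ _)
  simp only [smul_eq_mul, ← mul_sum, hsum'] at hJ
  replace hJ := mul_le_mul_of_nonneg_left hJ (by positivity : (0 : ℝ) ≤ q ^ n)
  rw [mul_inv_cancel_left₀ (by positivity)] at hJ
  refine le_of_eq_of_le ?_ hJ
  congr 2
  field_simp

theorem rpow_inv_le_self {x s : ℝ} (hx : 1 ≤ x) (hs : 1 ≤ s) : x ^ s⁻¹ ≤ x := by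
  simpa using Real.rpow_le_rpow_of_exponent_le hx (inv_le_one_of_one_le₀ hs)

/-- The expected number of `Λ`-avoiding permutations over the random `k`-uniform
hypergraph with edge probability `α`, namely `∑_σ (1-α)^{c(σ)}`, is at most
`exp(Cn) · α^(-n/(k-1))`. -/
theorem random_hypergraph_avoidance_upper (k : ℕ) (hk : 1 < k)
    (π : Equiv.Perm (Fin k)) :
    ∃ C : ℝ, ∀ n : ℕ, 0 < n → ∀ α : ℝ, 0 < α → α ≤ 1 →
      ∑ σ : Equiv.Perm (Fin n), (1 - α) ^ (permCopies π σ) ≤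
        Real.exp (C * n) * α ^ (-(n : ℝ) / ((k : ℝ) - 1)) := by
  obtain ⟨L, K, hL, hK, h⟩ := exists_sum_pow_permCopies_le hk π
  have hk0 : 0 < k := by omega
  have hkr : (1 : ℝ) ≤ (k : ℝ) - 1 := by
    have : (2 : ℝ) ≤ k := by exact_mod_cast hk
    linarith
  have hkc : ((k - 1 : ℕ) : ℝ) = (k : ℝ) - 1 := by
    rw [Nat.cast_sub hk.le, Nat.cast_one]
  refine ⟨Real.log (2 * L * K), fun n _ α hα0 hα1 => ?_⟩
  set s : ℝ := (k : ℝ) - 1 with hs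
  have hs0 : 0 < s := by linarith
  have hLα : 1 ≤ L / α := (one_le_div hα0).2 (hα1.trans hL)
  set y : ℝ := (L / α) ^ s⁻¹ with hy
  have hy1 : 1 ≤ y := Real.one_le_rpow hLα (by positivity)
  set q : ℕ := ⌈y⌉₊ with hqdef
  have hyq : y ≤ q := Nat.le_ceil y
  have hq0 : 0 < q := Nat.ceil_pos.2 (by linarith)
  have hq0' : (0 : ℝ) < q := by exact_mod_cast hq0
  have hqy : (q : ℝ) ≤ 2 * y := by
    have := Nat.ceil_lt_add_one (a := y) (by linarith)
    linarith
  have hqpow : L / q ^ (k - 1) ≤ α := by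
    have h1 : L / α ≤ (q : ℝ) ^ (k - 1) := by
      calc L / α = y ^ (k - 1) := by
            rw [hy, ← Real.rpow_natCast, ← Real.rpow_mul (by positivity), hkc,
              inv_mul_cancel₀ hs0.ne', Real.rpow_one]
        _ ≤ _ := pow_le_pow_left₀ (by linarith) hyq _
    rw [div_le_iff₀ hα0] at h1
    rw [div_le_iff₀ (by positivity)]
    linarith
  have hterm : ∀ σ : Equiv.Perm (Fin n),
      (1 - α) ^ permCopies π σ ≤ Real.exp (-(L / q ^ (k - 1)) * permCopies π σ) := by
    intro σ
    rw [mul_comm, Real.exp_nat_mul]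
    refine pow_le_pow_left₀ (by linarith) ?_ _
    have := Real.add_one_le_exp (-(L / (q : ℝ) ^ (k - 1)))
    linarith
  have hmain : (q : ℝ) ^ n * ∑ σ : Equiv.Perm (Fin n), (1 - α) ^ permCopies π σ ≤
      q ^ n * (q ^ n * K ^ n) := by
    calc _ ≤ ∑ σ : Equiv.Perm (Fin n), ∑ χ : Fin n → Fin q, _ := by
          rw [mul_sum]
          refine sum_le_sum fun σ _ => le_trans ?_ (exp_permCopies_le hk0 hq0 π L σ)
          exact mul_le_mul_of_nonneg_left (hterm σ) (by positivity)
      _ ≤ ∑ χ : Fin n → Fin q, (q ^ n * K ^ n : ℝ) := by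
          rw [sum_comm]
          exact sum_le_sum fun χ _ =>
            sum_exp_monochromatic_le hk0 (by linarith) (by linarith) h χ
      _ = _ := by simp
  have hmain' := le_of_mul_le_mul_left hmain (by positivity)
  refine hmain'.trans ?_
  have hyL : y ≤ L * α ^ (-s⁻¹) := by
    rw [hy, Real.div_rpow (by linarith) hα0.le, Real.rpow_neg hα0.le, div_eq_mul_inv]
    exact mul_le_mul_of_nonneg_right (rpow_inv_le_self hL hkr) (by positivity)
  calc (q : ℝ) ^ n * K ^ n = (q * K) ^ n := (mul_pow _ _ _).symm
    _ ≤ (2 * (L * α ^ (-s⁻¹)) * K) ^ n := by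
        refine pow_le_pow_left₀ (by positivity) ?_ _
        exact mul_le_mul_of_nonneg_right (by linarith) (by linarith)
    _ = (2 * L * K) ^ n * (α ^ (-s⁻¹)) ^ n := by rw [← mul_pow]; ring
    _ = _ := by
        rw [mul_comm (Real.log _), Real.exp_nat_mul, Real.exp_log (by positivity),
          ← Real.rpow_natCast (α ^ (-s⁻¹)), ← Real.rpow_mul hα0.le]
        congr 2
        field_simp
end
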